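/- arXiv:1309.3839 — 5 statements merged into one kernel-verified Lean document; each statement's English description precedes it below -/
import Mathlib

section
/- Let A be a commutative real C*-algebra and let V : A × A → ℝ be a bounded (continuous) real-bilinear orthogonal form. Then there exist bounded real-linear functionals φ₁ and φ₂ on A such that V(x, y) = φ₁(x·y) + φ₂(x·y*) for every x, y ∈ A. -/
lemma not_isUnit_of_mem_spectrum_of_mul {R : Type*} [Ring R] [Algebra ℂ R] {t : R} {z : ℂ}
    (hz : z ∈ spectrum ℂ t) (w : ℂ) :
    ¬ IsUnit ((algebraMap ℂ R z - t) * (algebraMap ℂ R w - t)) := by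
  have hc : Commute (algebraMap ℂ R z - t) (algebraMap ℂ R w - t) :=
    Commute.sub_left (Algebra.commutes _ _)
      (Commute.sub_right (Algebra.commutes _ _).symm (Commute.refl _))
  rw [hc.isUnit_mul_iff]
  exact fun h => hz h.1

/-- The complex Banach algebra of bounded operators on the space of complex-valued bounded
real-linear functionals. -/
abbrev DualEnd (B : Type*) [NormedCommRing B] [NormedAlgebra ℝ B] : Type _ :=
  (B →L[ℝ] ℂ) →L[ℂ] (B →L[ℝ] ℂ)

/-- A real Banach algebra acts on the complex Banach space of its complex-valued
real-linear functionals by precomposition with multiplication. -/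
noncomputable def dualAction (B : Type*) [NormedCommRing B] [NormedAlgebra ℝ B] :
    B →+* DualEnd B where
  toFun b := LinearMap.mkContinuous
    { toFun := fun f => f.comp (ContinuousLinearMap.mul ℝ B b)
      map_add' := fun f g => by ext; simp
      map_smul' := fun c f => by ext; simp } ‖b‖ (fun f => by
        refine (ContinuousLinearMap.opNorm_comp_le _ _).trans ?_
        rw [mul_comm]
        gcongr
        exact ContinuousLinearMap.opNorm_mul_apply_le ℝ B b)
  map_one' := by ext; simp
  map_mul' a b := by ext; simp [mul_left_comm, mul_assoc]
  map_zero' := by ext; simp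
  map_add' a b := by ext; simp

section RealBanach

variable {B : Type*} [NormedCommRing B] [NormedAlgebra ℝ B]

@[simp]
lemma dualAction_apply (b c : B) (f : B →L[ℝ] ℂ) : dualAction B b f c = f (b * c) := rfl

lemma norm_dualAction_le (b : B) : ‖dualAction B b‖ ≤ ‖b‖ := by
  refine ContinuousLinearMap.opNorm_le_bound _ (norm_nonneg b) fun f => ?_
  refine ContinuousLinearMap.opNorm_le_bound _ (by positivity) fun c => ?_
  rw [dualAction_apply]
  calc ‖f (b * c)‖ ≤ ‖f‖ * (‖b‖ * ‖c‖) := f.le_opNorm_of_le (norm_mul_le b c)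
    _ = ‖b‖ * ‖f‖ * ‖c‖ := by ring

lemma norm_dualAction [NormOneClass B] (b : B) : ‖dualAction B b‖ = ‖b‖ := by
  refine le_antisymm (norm_dualAction_le b) ?_
  obtain ⟨g, hg, hgb⟩ := exists_dual_vector'' ℝ b
  set f : B →L[ℝ] ℂ := Complex.ofRealCLM.comp g
  have hf : ‖f‖ ≤ 1 := by
    refine ContinuousLinearMap.opNorm_le_bound _ zero_le_one fun x => ?_
    simpa [f] using g.le_of_opNorm_le hg x
  have h1 : ‖dualAction B b f 1‖ = ‖b‖ := by
    simp [f, hgb]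
  calc ‖b‖ = ‖dualAction B b f 1‖ := h1.symm
    _ ≤ ‖dualAction B b f‖ * ‖(1 : B)‖ := ContinuousLinearMap.le_opNorm _ _
    _ ≤ ‖dualAction B b‖ * ‖f‖ * ‖(1 : B)‖ := by
        gcongr; exact ContinuousLinearMap.le_opNorm _ _
    _ ≤ ‖dualAction B b‖ * 1 * 1 := by gcongr; simp
    _ = ‖dualAction B b‖ := by ring

lemma not_isUnit_of_mem_spectrum_dualAction {b : B} {z : ℂ}
    (hz : z ∈ spectrum ℂ (dualAction B b)) :
    ¬ IsUnit ((b - algebraMap ℝ B z.re) ^ 2 + algebraMap ℝ B (z.im ^ 2)) := by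
  intro h
  refine not_isUnit_of_mem_spectrum_of_mul hz (starRingEnd ℂ z) ?_
  convert! h.map (dualAction B) using 1
  ext f c
  symm
  change f (_ * c) = z * (starRingEnd ℂ z * f c - f (b * c)) -
    (starRingEnd ℂ z * f (b * c) - f (b * (b * c)))
  have e : ((b - algebraMap ℝ B z.re) ^ 2 + algebraMap ℝ B (z.im ^ 2)) * c =
      b * (b * c) - (2 * z.re) • (b * c) + (z.re ^ 2 + z.im ^ 2) • c := by
    simp only [Algebra.smul_def, map_mul, map_add, map_pow, map_ofNat]; ring
  have hn : ((z.re : ℂ) ^ 2 + (z.im : ℂ) ^ 2) = z * (starRingEnd ℂ z) := by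
    rw [Complex.mul_conj, Complex.normSq_apply]; push_cast; ring
  have hs : (2 * (z.re : ℂ)) = z + (starRingEnd ℂ z) := by
    rw [Complex.add_conj]; push_cast; ring
  rw [e, map_add, map_sub, map_smul, map_smul, Complex.real_smul, Complex.real_smul]
  push_cast
  rw [hn, hs]
  ring

lemma exists_not_isUnit_quadratic [Nontrivial B] (b : B) :
    ∃ z : ℂ, (‖z‖₊ : ENNReal) = spectralRadius ℂ (dualAction B b) ∧
      ¬ IsUnit ((b - algebraMap ℝ B z.re) ^ 2 + algebraMap ℝ B (z.im ^ 2)) := by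
  have : Nontrivial (B →L[ℝ] ℂ) := by
    obtain ⟨b, hb⟩ := exists_ne (0 : B)
    obtain ⟨g, -, hgb⟩ := exists_dual_vector'' ℝ b
    refine ⟨⟨Complex.ofRealCLM.comp g, 0, fun h => hb ?_⟩⟩
    have := DFunLike.congr_fun h b
    simpa [hgb] using this
  obtain ⟨z, hz, hzr⟩ := spectrum.exists_nnnorm_eq_spectralRadius (dualAction B b)
  exact ⟨z, hzr, not_isUnit_of_mem_spectrum_dualAction hz⟩

variable [CompleteSpace B]

lemma exists_algHom_complex_eq_zero {q : B} (hq : ¬ IsUnit q) :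
    ∃ χ : B →ₐ[ℝ] ℂ, χ q = 0 := by
  obtain ⟨M, hM, hqM⟩ := exists_max_ideal_of_mem_nonunits hq
  have : IsClosed (M : Set B) := Ideal.IsMaximal.isClosed
  let _ : Field (B ⧸ M) := Ideal.Quotient.field M
  have halg : Algebra.IsAlgebraic ℝ (B ⧸ M) := by
    refine ⟨fun k => ?_⟩
    obtain ⟨z, -, hz⟩ := exists_not_isUnit_quadratic k
    have h0 : (k - algebraMap ℝ (B ⧸ M) z.re) ^ 2 + algebraMap ℝ (B ⧸ M) (z.im ^ 2) = 0 := by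
      by_contra h
      obtain ⟨c, hc⟩ := Ideal.Quotient.exists_inv h
      exact hz (IsUnit.of_mul_eq_one c hc)
    refine ⟨(Polynomial.X - Polynomial.C z.re) ^ 2 + Polynomial.C (z.im ^ 2), ?_, by simpa using h0⟩
    intro h
    have h2 := congrArg (fun p => Polynomial.coeff p 2) h
    have e : ((Polynomial.X - Polynomial.C z.re) ^ 2 + Polynomial.C (z.im ^ 2) :
        Polynomial ℝ) = Polynomial.C 1 * Polynomial.X ^ 2 + Polynomial.C (-2 * z.re) * Polynomial.X
          + Polynomial.C (z.re ^ 2 + z.im ^ 2) := by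
      simp only [Polynomial.C_add, Polynomial.C_mul, Polynomial.C_pow, Polynomial.C_neg,
        Polynomial.C_1, Polynomial.C_ofNat]
      ring
    simp only [e, Polynomial.coeff_add, Polynomial.coeff_C_mul, Polynomial.coeff_X_pow,
      Polynomial.coeff_X, Polynomial.coeff_C, Polynomial.coeff_zero] at h2
    norm_num at h2
  refine ⟨(IsAlgClosed.lift (R := ℝ) (S := B ⧸ M) (M := ℂ)).comp (Ideal.Quotient.mkₐ ℝ M), ?_⟩
  simp [Ideal.Quotient.eq_zero_iff_mem.mpr hqM]

open Filter Topology in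
lemma exists_algHom_norm_eq [NormOneClass B] (b : B)
    (hb : ∀ n : ℕ, ‖b ^ 2 ^ n‖ = ‖b‖ ^ 2 ^ n) : ∃ χ : B →ₐ[ℝ] ℂ, ‖χ b‖ = ‖b‖ := by
  have : Nontrivial B := NormOneClass.nontrivial
  obtain ⟨z, hz, hu⟩ := exists_not_isUnit_quadratic b
  have hr : spectralRadius ℂ (dualAction B b) = ‖b‖₊ := by
    have hconst : Tendsto (fun _n : ℕ => (‖b‖₊ : ENNReal)) atTop _ := tendsto_const_nhds
    refine tendsto_nhds_unique ?_ hconst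
    convert!
      (spectrum.pow_nnnorm_pow_one_div_tendsto_nhds_spectralRadius (dualAction B b)).comp
        (tendsto_pow_atTop_atTop_of_one_lt one_lt_two) using 1
    refine funext fun n => ?_
    have h1 : ‖dualAction B b ^ 2 ^ n‖₊ = ‖b‖₊ ^ 2 ^ n := by
      ext
      rw [← map_pow, coe_nnnorm, norm_dualAction, hb]
      simp
    rw [Function.comp_apply, h1, ENNReal.coe_pow, ← ENNReal.rpow_natCast, ← ENNReal.rpow_mul]
    simp
  obtain ⟨χ, hχ⟩ := exists_algHom_complex_eq_zero hu
  refine ⟨χ, ?_⟩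
  rw [hr] at hz
  have hz' : ‖z‖ = ‖b‖ := by simpa using congrArg ENNReal.toReal hz
  simp only [map_add, map_pow, map_sub, AlgHom.commutes, Complex.coe_algebraMap] at hχ
  have hfac : (χ b - z) * (χ b - starRingEnd ℂ z) = 0 := by
    have hn : (z.re : ℂ) ^ 2 + (z.im : ℂ) ^ 2 = z * (starRingEnd ℂ z) := by
      rw [Complex.mul_conj, Complex.normSq_apply]; push_cast; ring
    have hs : (2 * (z.re : ℂ)) = z + (starRingEnd ℂ z) := by
      rw [Complex.add_conj]; push_cast; ring
    linear_combination hχ - hn + χ b * hs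
  rcases mul_eq_zero.mp hfac with h | h
  · rw [sub_eq_zero.mp h, hz']
  · rw [sub_eq_zero.mp h, RCLike.norm_conj, hz']

end RealBanach

section Characters
variable {A : Type*} [NonUnitalNormedCommRing A] [StarRing A] [CStarRing A]
    [NormedSpace ℝ A] [IsScalarTower ℝ A A] [SMulCommClass ℝ A A]

noncomputable instance Unitization.instNormedCommRingReal : NormedCommRing (Unitization ℝ A) :=
  { Unitization.instNormedRing, Unitization.instCommRing with }

lemma norm_inr_pow_two_pow {h : A} (hh : star h = h) (n : ℕ) :
    ‖(Unitization.inr h : Unitization ℝ A) ^ 2 ^ n‖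
      = ‖(Unitization.inr h : Unitization ℝ A)‖ ^ 2 ^ n := by
  have key : ∃ k : A, star k = k ∧ (Unitization.inr h : Unitization ℝ A) ^ 2 ^ n = Unitization.inr k
      ∧ ‖k‖ = ‖h‖ ^ 2 ^ n := by
    induction n with
    | zero => exact ⟨h, hh, by simp, by simp⟩
    | succ n ih =>
      obtain ⟨k, hk, hp, hn⟩ := ih
      refine ⟨k * k, by rw [star_mul, hk], ?_, ?_⟩
      · rw [pow_succ, pow_mul, hp, pow_two, Unitization.inr_mul]
      · have := CStarRing.norm_star_mul_self (x := k)
        rw [hk, hn] at this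
        rw [this]; ring
  obtain ⟨k, -, hp, hn⟩ := key
  rw [hp, Unitization.norm_inr, Unitization.norm_inr, hn]

variable [CompleteSpace A]

lemma nonUnitalAlgHom_apply_ne_one {g : A} (hg : ‖g‖ < 1) (χ : A →ₙₐ[ℝ] ℂ) : χ g ≠ 1 := by
  intro h
  have hu : IsUnit (1 - (Unitization.inr g : Unitization ℝ A)) :=
    isUnit_one_sub_of_norm_lt_one (by rwa [Unitization.norm_inr])
  have := (hu.map (Unitization.lift χ)).ne_zero
  have hg1 : Unitization.lift χ (Unitization.inr g) = 1 := by simp [h]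
  simp [map_sub, hg1, -Unitization.lift_apply] at this

lemma norm_character_apply_le (χ : A →⋆ₙₐ[ℝ] ℂ) (a : A) : ‖χ a‖ ≤ ‖a‖ := by
  by_contra! hlt
  have hpos : 0 < ‖χ a‖ := (norm_nonneg a).trans_lt hlt
  refine nonUnitalAlgHom_apply_ne_one (g := (‖χ a‖ ^ 2)⁻¹ • (star a * a)) ?_ χ.toNonUnitalAlgHom ?_
  · rw [norm_smul, CStarRing.norm_star_mul_self, norm_inv, norm_pow, norm_norm,
      inv_mul_lt_one₀ (by positivity), ← pow_two]
    gcongr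
  · change χ _ = 1
    rw [map_smul, map_mul, map_star, Complex.star_def, ← Complex.normSq_eq_conj_mul_self,
      Complex.normSq_eq_norm_sq, Complex.real_smul, ← Complex.ofReal_mul,
      inv_mul_cancel₀ (by positivity), Complex.ofReal_one]

variable [StarModule ℝ A]

lemma exists_character_norm_eq (hA : ∀ a : A, IsUnit ((1 : Unitization ℝ A) +
      star (Unitization.inr a : Unitization ℝ A) * (Unitization.inr a : Unitization ℝ A)))
    (a : A) : ∃ χ : A →⋆ₙₐ[ℝ] ℂ, ‖χ a‖ = ‖a‖ := by
  have hstar : ∀ (χ : Unitization ℝ A →ₐ[ℝ] ℂ) (x : A),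
      χ (Unitization.inr (star x)) * χ (Unitization.inr x) ≠ -1 := by
    intro χ x h
    have := ((hA x).map χ).ne_zero
    rw [map_add, map_one, map_mul, ← Unitization.inr_star, h] at this
    simp at this
  -- characters are real on selfadjoint elements
  have hreal : ∀ (χ : Unitization ℝ A →ₐ[ℝ] ℂ) (x : A), star x = x →
      (χ (Unitization.inr x)).im = 0 := by
    intro χ x hx
    by_contra him
    set w := χ (Unitization.inr x) with hw
    have hw0 : w ≠ 0 := fun h => him (by simp [h])
    set v := Complex.I / w
    set c := v.im / w.im
    set d := v.re - c * w.re
    have hv : (c : ℂ) * w + d = v := by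
      apply Complex.ext <;> simp [c, d, him]
    refine hstar χ (c • (x * x) + d • x) ?_
    have hs : star (c • (x * x) + d • x) = c • (x * x) + d • x := by
      simp [hx]
    have hval : χ (Unitization.inr (c • (x * x) + d • x)) = Complex.I := by
      rw [Unitization.inr_add, Unitization.inr_smul, Unitization.inr_smul, Unitization.inr_mul,
        map_add, map_smul, map_smul, map_mul, ← hw, Complex.real_smul, Complex.real_smul]
      have : w * v = Complex.I := by simp only [v]; field_simp
      rw [← hv] at this
      linear_combination this
    rw [hs, hval, Complex.I_mul_I]
  have hskew : ∀ (χ : Unitization ℝ A →ₐ[ℝ] ℂ) (x : A), star x = -x →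
      (χ (Unitization.inr x)).re = 0 := by
    intro χ x hx
    by_contra hre
    set w := χ (Unitization.inr x) with hw
    have h1 := hreal χ (x * x) (by simp [hx])
    rw [Unitization.inr_mul, map_mul, ← hw, Complex.mul_im] at h1
    have him : w.im = 0 := by
      have : w.re * w.im = 0 := by linarith
      exact (mul_eq_zero.mp this).resolve_left hre
    refine hstar χ (w.re⁻¹ • x) ?_
    have hww : w = (w.re : ℂ) := Complex.ext rfl (by simp [him])
    have : χ (Unitization.inr (w.re⁻¹ • x)) = 1 := by
      rw [Unitization.inr_smul, map_smul, ← hw, Complex.real_smul, hww]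
      simp [hre]
    rw [star_smul, hx, smul_neg, Unitization.inr_neg, map_neg, star_trivial, this]
    simp
  have hsa : star (star a * a) = star a * a := by simp [mul_comm]
  obtain ⟨χ, hχ⟩ := exists_algHom_norm_eq (Unitization.inr (star a * a) : Unitization ℝ A)
    (norm_inr_pow_two_pow hsa)
  have hχstar : ∀ x : A, χ (Unitization.inr (star x)) = star (χ (Unitization.inr x)) := by
    intro x
    have h1 := hreal χ (x + star x) (by simp [add_comm])
    have h2 := hskew χ (x - star x) (by simp)
    rw [Unitization.inr_add, map_add, Complex.add_im] at h1
    rw [Unitization.inr_sub, map_sub, Complex.sub_re] at h2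
    apply Complex.ext
    · rw [Complex.star_def, Complex.conj_re]; linarith
    · rw [Complex.star_def, Complex.conj_im]; linarith
  let ψ : A →⋆ₙₐ[ℝ] ℂ :=
    { (χ : Unitization ℝ A →ₙₐ[ℝ] ℂ).comp (Unitization.inrNonUnitalAlgHom ℝ A) with
      map_star' := hχstar }
  have hψ : ∀ x, ψ x = χ (Unitization.inr x) := fun _ => rfl
  refine ⟨ψ, ?_⟩
  rw [Unitization.norm_inr, ← hψ, map_mul, map_star, norm_mul, norm_star,
    CStarRing.norm_star_mul_self] at hχ
  nlinarith [norm_nonneg a, norm_nonneg (ψ a)]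

end Characters

section Rademacher

variable {ι : Type*} [DecidableEq ι] (s : Finset ι) (a : ι → ℝ)

lemma sum_powerset_insert_signed {j : ι} {s : Finset ι} (hj : j ∉ s) (a : ι → ℝ) (g : ℝ → ℝ) :
    ∑ T ∈ (insert j s).powerset, g (2 * ∑ i ∈ T, a i - ∑ i ∈ insert j s, a i) =
      ∑ T ∈ s.powerset, (g (2 * ∑ i ∈ T, a i - ∑ i ∈ s, a i - a j) +
        g (2 * ∑ i ∈ T, a i - ∑ i ∈ s, a i + a j)) := by
  rw [Finset.sum_powerset_insert hj, ← Finset.sum_add_distrib]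
  refine Finset.sum_congr rfl fun T hT => ?_
  have hjT : j ∉ T := fun h => hj (Finset.mem_powerset.mp hT h)
  rw [Finset.sum_insert hj, Finset.sum_insert hjT]
  congr 2 <;> ring

lemma sum_powerset_signed_sq :
    ∑ T ∈ s.powerset, (2 * ∑ i ∈ T, a i - ∑ i ∈ s, a i) ^ 2 = 2 ^ s.card * ∑ i ∈ s, a i ^ 2 := by
  induction s using Finset.induction_on with
  | empty => simp
  | insert j s hj ih =>
    rw [sum_powerset_insert_signed hj a (fun x => x ^ 2), Finset.sum_insert hj,
      Finset.card_insert_of_notMem hj]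
    have e : ∀ t : ℝ, (t - a j) ^ 2 + (t + a j) ^ 2 = 2 * t ^ 2 + 2 * a j ^ 2 := fun t => by ring
    simp only [e, Finset.sum_add_distrib, ← Finset.mul_sum, ih, Finset.sum_const,
      Finset.card_powerset, nsmul_eq_mul]
    push_cast
    ring

lemma sum_powerset_signed_pow_four_le :
    ∑ T ∈ s.powerset, (2 * ∑ i ∈ T, a i - ∑ i ∈ s, a i) ^ 4 ≤
      3 * 2 ^ s.card * (∑ i ∈ s, a i ^ 2) ^ 2 := by
  induction s using Finset.induction_on with
  | empty => simp
  | insert j s hj ih =>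
    rw [sum_powerset_insert_signed hj a (fun x => x ^ 4), Finset.sum_insert hj,
      Finset.card_insert_of_notMem hj]
    have e : ∀ t : ℝ, (t - a j) ^ 4 + (t + a j) ^ 4 =
      2 * t ^ 4 + 12 * a j ^ 2 * t ^ 2 + 2 * a j ^ 4 := fun t => by ring
    simp only [e, Finset.sum_add_distrib, ← Finset.mul_sum, sum_powerset_signed_sq,
      Finset.sum_const, Finset.card_powerset, nsmul_eq_mul]
    push_cast
    have h2 : (0 : ℝ) ≤ 2 ^ s.card * a j ^ 4 := by positivity
    rw [pow_succ (2 : ℝ)]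
    nlinarith

lemma half_le_sum_powerset_truncated (ha : ∑ i ∈ s, a i ^ 2 = 1) :
    (2 : ℝ) ^ s.card / 2 ≤ ∑ T ∈ s.powerset,
      ((2 * ∑ i ∈ T, a i - ∑ i ∈ s, a i) /
        (1 + (2 * ∑ i ∈ T, a i - ∑ i ∈ s, a i) ^ 2 / 12)) ^ 2 := by
  have hpt : ∀ t : ℝ, t ^ 2 - t ^ 4 / 6 ≤ (t / (1 + t ^ 2 / 12)) ^ 2 := by
    intro t
    rw [div_pow, le_div_iff₀ (by positivity)]
    have : t ^ 2 - (t ^ 2 - t ^ 4 / 6) * (1 + t ^ 2 / 12) ^ 2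
        = t ^ 6 / 48 + t ^ 8 / 864 := by ring
    have h6 : 0 ≤ t ^ 6 := by positivity
    have h8 : 0 ≤ t ^ 8 := by positivity
    linarith
  refine le_trans ?_ (Finset.sum_le_sum fun T _ => hpt _)
  rw [Finset.sum_sub_distrib, ← Finset.sum_div, sum_powerset_signed_sq, ha]
  have := sum_powerset_signed_pow_four_le s a
  rw [ha] at this
  linarith

end Rademacher

lemma abs_div_one_add_sq_le (t : ℝ) : |t / (1 + t ^ 2 / 12)| ≤ 2 := by
  rw [abs_div, abs_of_pos (show 0 < 1 + t ^ 2 / 12 by positivity), div_le_iff₀ (by positivity)]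
  have := sq_abs t
  nlinarith [sq_nonneg (|t| - 3)]

/-- The piecewise linear bump of height one supported on `[k - 1, k + 1]`. -/
noncomputable def hat (k : ℤ) (t : ℝ) : ℝ := max 0 (1 - |t - k|)

@[fun_prop]
lemma continuous_hat (k : ℤ) : Continuous (hat k) := by unfold hat; fun_prop

lemma hat_mul_hat_eq_zero {k l : ℤ} (h : 2 ≤ |k - l|) (t : ℝ) : hat k t * hat l t = 0 := by
  have h' : (2 : ℝ) ≤ |(k : ℝ) - l| := by exact_mod_cast h
  have h3 : |(k : ℝ) - l| ≤ |t - k| + |t - l| := by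
    rw [abs_sub_comm t k]
    simpa using abs_add_le ((k : ℝ) - t) (t - l)
  by_cases hk : 1 ≤ |t - k|
  · rw [hat, max_eq_left (by linarith), zero_mul]
  · rw [hat, hat, max_eq_left (a := (0 : ℝ)) (b := 1 - |t - l|) (by linarith), mul_zero]

lemma sum_hat_mul {K : ℤ} {t : ℝ} (ht : |t| < K) (g : ℤ → ℝ) :
    ∑ k ∈ Finset.Icc (-K) K, g k * hat k t =
      (1 - Int.fract t) * g ⌊t⌋ + Int.fract t * g (⌊t⌋ + 1) := by
  have h0 := Int.fract_nonneg t
  have h1 := Int.fract_lt_one t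
  have hfl : t = ⌊t⌋ + Int.fract t := (Int.floor_add_fract t).symm
  obtain ⟨hl, hr⟩ := abs_lt.mp ht
  have hlK : -K ≤ ⌊t⌋ := Int.le_floor.mpr (by push_cast; exact hl.le)
  have hrK : ⌊t⌋ < K := Int.floor_lt.mpr hr
  rw [Finset.sum_eq_add_of_mem ⌊t⌋ (⌊t⌋ + 1) (by simp; omega) (by simp; omega) (by omega)]
  · have e1 : hat ⌊t⌋ t = 1 - Int.fract t := by
      have : t - ⌊t⌋ = Int.fract t := rfl
      rw [hat, this, abs_of_nonneg h0, max_eq_right (by linarith)]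
    have e2 : hat (⌊t⌋ + 1) t = Int.fract t := by
      have : t - ((⌊t⌋ + 1 : ℤ) : ℝ) = Int.fract t - 1 := by
        push_cast; rw [← Int.self_sub_floor]; ring
      rw [hat, this, abs_of_nonpos (by linarith), max_eq_right (by linarith)]
      ring
    rw [e1, e2]; ring
  · rintro k - ⟨hk1, hk2⟩
    have : 1 ≤ |t - k| := by
      rcases lt_or_gt_of_ne hk1 with h | h
      · have : (k : ℝ) + 1 ≤ ⌊t⌋ := by exact_mod_cast h
        exact (by linarith : 1 ≤ t - k).trans (le_abs_self _)
      · have : (⌊t⌋ : ℝ) + 2 ≤ k := by exact_mod_cast (by omega : ⌊t⌋ + 2 ≤ k)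
        exact (by linarith : 1 ≤ -(t - k)).trans (neg_le_abs _)
    rw [hat, max_eq_left (by linarith), mul_zero]

lemma abs_sum_hat_mul_le {K : ℤ} {t : ℝ} (ht : |t| < K) {g : ℤ → ℝ} (hg : ∀ k, |g k| ≤ 1) :
    |∑ k ∈ Finset.Icc (-K) K, g k * hat k t| ≤ 1 := by
  have h0 := Int.fract_nonneg t
  have h1 := Int.fract_lt_one t
  have ha := abs_le.mp (hg ⌊t⌋)
  have hb := abs_le.mp (hg (⌊t⌋ + 1))
  rw [sum_hat_mul ht, abs_le]
  constructor <;> nlinarith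

section FunctionalCalculus

variable {A : Type*} [NonUnitalNormedCommRing A] [StarRing A] [NormedSpace ℝ A]

lemma norm_le_of_forall_character (hn : ∀ a : A, ∃ χ : A →⋆ₙₐ[ℝ] ℂ, ‖χ a‖ = ‖a‖)
    {a : A} {C : ℝ} (h : ∀ χ : A →⋆ₙₐ[ℝ] ℂ, ‖χ a‖ ≤ C) : ‖a‖ ≤ C := by
  obtain ⟨χ, hχ⟩ := hn a
  exact hχ ▸ h χ

lemma ext_of_forall_character (hn : ∀ a : A, ∃ χ : A →⋆ₙₐ[ℝ] ℂ, ‖χ a‖ = ‖a‖)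
    {a b : A} (h : ∀ χ : A →⋆ₙₐ[ℝ] ℂ, χ a = χ b) : a = b := by
  rw [← sub_eq_zero, ← norm_le_zero_iff]
  exact norm_le_of_forall_character hn fun χ => by simp [h χ]

lemma character_eq_ofReal_re {z : A} (hz : star z = z) (χ : A →⋆ₙₐ[ℝ] ℂ) :
    χ z = ((χ z).re : ℂ) := by
  rw [eq_comm, ← Complex.conj_eq_iff_re, ← Complex.star_def, ← map_star, hz]

variable [SMulCommClass ℝ A A]

lemma character_aeval_mulLeft {z : A} (hz : star z = z) (x : A) (p : Polynomial ℝ)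
    (χ : A →⋆ₙₐ[ℝ] ℂ) :
    χ (Polynomial.aeval (LinearMap.mulLeft ℝ z) p x) = ((p.eval (χ z).re : ℝ) : ℂ) * χ x := by
  induction p using Polynomial.induction_on' with
  | add p q hp hq => simp [hp, hq, add_mul]
  | monomial n r =>
    have hpow : χ ((LinearMap.mulLeft ℝ z ^ n) x) = χ z ^ n * χ x := by
      induction n with
      | zero => simp
      | succ n ih =>
        rw [pow_succ', Module.End.mul_apply, LinearMap.mulLeft_apply, map_mul, ih]
        ring
    rw [Polynomial.aeval_monomial, Module.End.mul_apply, Module.algebraMap_end_apply, map_smul,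
      hpow, Polynomial.eval_monomial, Complex.real_smul]
    conv_lhs => rw [character_eq_ofReal_re hz]
    push_cast
    ring

variable [IsScalarTower ℝ A A] [CStarRing A] [CompleteSpace A]

open Filter Topology in
/-- Multiplication of `x` by a continuous function of the selfadjoint element `z`. -/
lemma exists_continuous_functional_mul (hn : ∀ a : A, ∃ χ : A →⋆ₙₐ[ℝ] ℂ, ‖χ a‖ = ‖a‖)
    {z : A} (hz : star z = z) (x : A) {F : ℝ → ℝ} (hF : Continuous F) :
    ∃ b : A, ∀ χ : A →⋆ₙₐ[ℝ] ℂ, χ b = (F (χ z).re : ℂ) * χ x := by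
  have hp (n : ℕ) := exists_polynomial_near_of_continuousOn (-‖z‖) ‖z‖ F hF.continuousOn
    (1 / ((n : ℝ) + 1)) (by positivity)
  choose p hp using hp
  set b : ℕ → A := fun n => Polynomial.aeval (LinearMap.mulLeft ℝ z) (p n) x
  have hmem (χ : A →⋆ₙₐ[ℝ] ℂ) : (χ z).re ∈ Set.Icc (-‖z‖) ‖z‖ :=
    abs_le.mp ((Complex.abs_re_le_norm _).trans (norm_character_apply_le χ z))
  have hb (n : ℕ) (χ : A →⋆ₙₐ[ℝ] ℂ) :
      ‖χ (b n) - (F (χ z).re : ℂ) * χ x‖ ≤ 1 / ((n : ℝ) + 1) * ‖x‖ := by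
    rw [character_aeval_mulLeft hz, ← sub_mul, norm_mul, ← Complex.ofReal_sub,
      Complex.norm_real, Real.norm_eq_abs]
    gcongr
    · exact (hp n _ (hmem χ)).le
    · exact norm_character_apply_le χ x
  have hlim : Tendsto (fun n : ℕ => 1 / ((n : ℝ) + 1) * ‖x‖) atTop (𝓝 0) := by
    simpa using tendsto_one_div_add_atTop_nhds_zero_nat.mul_const ‖x‖
  have hcauchy : CauchySeq b := by
    refine cauchySeq_of_le_tendsto_0 (fun n : ℕ => 2 * (1 / ((n : ℝ) + 1) * ‖x‖)) ?_
      (by simpa using hlim.const_mul 2)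
    intro n m N hnN hmN
    rw [dist_eq_norm]
    refine norm_le_of_forall_character hn fun χ => ?_
    have hn' : 1 / ((n : ℝ) + 1) * ‖x‖ ≤ 1 / ((N : ℝ) + 1) * ‖x‖ := by gcongr
    have hm' : 1 / ((m : ℝ) + 1) * ‖x‖ ≤ 1 / ((N : ℝ) + 1) * ‖x‖ := by gcongr
    have h := norm_sub_le_norm_sub_add_norm_sub (χ (b n)) ((F (χ z).re : ℂ) * χ x) (χ (b m))
    rw [norm_sub_rev ((F (χ z).re : ℂ) * χ x)] at h
    rw [map_sub]
    linarith [hb n χ, hb m χ]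
  obtain ⟨c, hc⟩ := cauchySeq_tendsto_of_complete hcauchy
  refine ⟨c, fun χ => ?_⟩
  have hχ : Continuous χ :=
    AddMonoidHomClass.continuous_of_bound χ 1 fun a => by
      simpa using norm_character_apply_le χ a
  refine tendsto_nhds_unique ((hχ.tendsto c).comp hc) ?_
  rw [tendsto_iff_norm_sub_tendsto_zero]
  exact squeeze_zero (fun _ => norm_nonneg _) (fun n => hb n χ) hlim

lemma abs_balance_le (hn : ∀ a : A, ∃ χ : A →⋆ₙₐ[ℝ] ℂ, ‖χ a‖ = ‖a‖)
    (V : A →L[ℝ] A →L[ℝ] ℝ) (hV : ∀ a c : A, a * c = 0 → V a c = 0)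
    {z : A} (hz : star z = z) (x y : A) :
    |V (z * x) y - V x (z * y)| ≤ 2 * (‖V‖ * ‖x‖ * ‖y‖) := by
  choose m hm using fun (k : ℤ) (x : A) =>
    exists_continuous_functional_mul hn hz x (continuous_hat k)
  obtain ⟨K, hK⟩ := exists_int_gt ‖z‖
  have hlt (χ : A →⋆ₙₐ[ℝ] ℂ) : |(χ z).re| < K :=
    ((Complex.abs_re_le_norm _).trans (norm_character_apply_le χ z)).trans_lt hK
  set I := Finset.Icc (-K) K
  have hval (g : ℤ → ℝ) (x : A) (χ : A →⋆ₙₐ[ℝ] ℂ) :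
      χ (∑ k ∈ I, g k • m k x) = ((∑ k ∈ I, g k * hat k (χ z).re : ℝ) : ℂ) * χ x := by
    simp only [map_sum, map_smul, hm, Complex.real_smul, Complex.ofReal_sum, Complex.ofReal_mul,
      Finset.sum_mul, mul_assoc]
  have hnorm (g : ℤ → ℝ) (hg : ∀ k, |g k| ≤ 1) (x : A) : ‖∑ k ∈ I, g k • m k x‖ ≤ ‖x‖ := by
    refine norm_le_of_forall_character hn fun χ => ?_
    rw [hval, norm_mul, Complex.norm_real, Real.norm_eq_abs]
    exact (mul_le_of_le_one_left (norm_nonneg _) (abs_sum_hat_mul_le (hlt χ) hg)).trans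
      (norm_character_apply_le χ x)
  have hone (x : A) : ∑ k ∈ I, (1 : ℝ) • m k x = x :=
    ext_of_forall_character hn fun χ => by
      rw [hval (fun _ => 1), sum_hat_mul (hlt χ)]; simp
  have hid (x : A) : ∑ k ∈ I, (k : ℝ) • m k x = z * x :=
    ext_of_forall_character hn fun χ => by
      rw [hval (fun k => k), sum_hat_mul (hlt χ), map_mul, character_eq_ofReal_re hz χ,
        Complex.ofReal_re]
      congr 2
      push_cast
      linear_combination Int.floor_add_fract (χ z).re
  have hexp (g h : ℤ → ℝ) : V (∑ k ∈ I, g k • m k x) (∑ l ∈ I, h l • m l y) =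
      ∑ k ∈ I, ∑ l ∈ I, g k * h l * V (m k x) (m l y) := by
    simp only [map_sum, map_smul, sum_apply, smul_apply,
      smul_eq_mul, Finset.mul_sum, mul_assoc]
    rw [Finset.sum_comm]
    refine Finset.sum_congr rfl fun k _ => Finset.sum_congr rfl fun l _ => by ring
  have hterm (k l : ℤ) : ((k : ℝ) - l) * V (m k x) (m l y) =
      Real.sin (k * (Real.pi / 2) - l * (Real.pi / 2)) * V (m k x) (m l y) := by
    by_cases h : 2 ≤ |k - l|
    · rw [hV (m k x) (m l y)]
      · simp
      refine ext_of_forall_character hn fun χ => ?_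
      rw [map_mul, hm, hm, mul_mul_mul_comm, ← Complex.ofReal_mul, hat_mul_hat_eq_zero h]
      simp
    · congr 1
      obtain ⟨h1, h2⟩ := abs_lt.mp (not_le.mp h)
      rw [← sub_mul]
      have : k - l = -1 ∨ k - l = 0 ∨ k - l = 1 := by omega
      rcases this with h | h | h <;>
      · have h' := congrArg (fun j : ℤ => (j : ℝ)) h
        push_cast at h'
        rw [h']
        simp
  set S : ℤ → ℝ := fun k => Real.sin (k * (Real.pi / 2))
  set C : ℤ → ℝ := fun k => Real.cos (k * (Real.pi / 2))
  have hS (k) : |S k| ≤ 1 := Real.abs_sin_le_one _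
  have hC (k) : |C k| ≤ 1 := Real.abs_cos_le_one _
  have hkey : V (z * x) y - V x (z * y) =
      V (∑ k ∈ I, S k • m k x) (∑ l ∈ I, C l • m l y) -
      V (∑ k ∈ I, C k • m k x) (∑ l ∈ I, S l • m l y) := by
    have h1 := hexp (fun k => k) (fun _ => 1)
    have h2 := hexp (fun _ => 1) (fun k => k)
    rw [hid, hone] at h1 h2
    rw [h1, h2, hexp, hexp]
    simp only [← Finset.sum_sub_distrib]
    refine Finset.sum_congr rfl fun k _ => Finset.sum_congr rfl fun l _ => ?_
    have := hterm k l
    rw [Real.sin_sub] at this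
    linear_combination this
  have hbd (g h : ℤ → ℝ) (hg : ∀ k, |g k| ≤ 1) (hh : ∀ k, |h k| ≤ 1) :
      |V (∑ k ∈ I, g k • m k x) (∑ l ∈ I, h l • m l y)| ≤ ‖V‖ * ‖x‖ * ‖y‖ := by
    refine (V.le_opNorm₂ _ _).trans ?_
    gcongr
    · exact hnorm g hg x
    · exact hnorm h hh y
  rw [hkey]
  refine (abs_sub _ _).trans ?_
  linarith [hbd S C hS hC, hbd C S hC hS]

/-- Orthogonal forms are balanced over the selfadjoint part. -/
lemma orthogonal_form_balanced (hn : ∀ a : A, ∃ χ : A →⋆ₙₐ[ℝ] ℂ, ‖χ a‖ = ‖a‖)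
    [StarModule ℝ A]
    (V : A →L[ℝ] A →L[ℝ] ℝ) (hV : ∀ a c : A, a * c = 0 → V a c = 0)
    {z : A} (hz : star z = z) (x y : A) : V (z * x) y = V x (z * y) := by
  rw [← sub_eq_zero]
  by_contra h
  obtain ⟨n, hn'⟩ := exists_nat_gt (2 * (‖V‖ * ‖x‖ * ‖y‖) / |V (z * x) y - V x (z * y)|)
  rw [div_lt_iff₀ (abs_pos.mpr h)] at hn'
  have hb := abs_balance_le hn V hV (z := (n : ℝ) • z) (by simp [hz]) x y
  simp only [smul_mul_assoc, map_smul, smul_apply, smul_eq_mul,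
    ← mul_sub, abs_mul, Nat.abs_cast] at hb
  linarith

end FunctionalCalculus

section Bound

variable {A : Type*} [NonUnitalNormedCommRing A] [StarRing A] [NormedSpace ℝ A]

/-- On the eigenspaces of the involution, characters take values in a fixed line `ℝ ∙ c`. -/
lemma exists_character_phase {σ : ℝ} (hσ : σ = 1 ∨ σ = -1) :
    ∃ c : ℂ, ‖c‖ = 1 ∧ starRingEnd ℂ (c * c) = c * c ∧
      ∀ b : A, star b = σ • b → ∀ χ : A →⋆ₙₐ[ℝ] ℂ, ∃ r : ℝ, χ b = c * r := by
  rcases hσ with rfl | rfl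
  · refine ⟨1, by simp, by simp, fun b hb χ => ⟨(χ b).re, ?_⟩⟩
    rw [one_mul]
    exact character_eq_ofReal_re (by simpa using hb) χ
  · refine ⟨Complex.I, by simp, by simp, fun b hb χ => ⟨(χ b).im, ?_⟩⟩
    have h := congrArg (fun a => (χ a).re) hb
    simp only [map_star, Complex.star_def, Complex.conj_re, neg_smul, one_smul, map_neg,
      Complex.neg_re] at h
    apply Complex.ext
    · simp; linarith
    · simp

lemma character_star_mul_self {a : A} {χ : A →⋆ₙₐ[ℝ] ℂ} {c : ℂ} (hc : ‖c‖ = 1) {r : ℝ}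
    (h : χ a = c * r) : χ (star a * a) = ((r ^ 2 : ℝ) : ℂ) := by
  rw [map_mul, map_star, Complex.star_def, ← Complex.normSq_eq_conj_mul_self, h,
    Complex.normSq_eq_norm_sq, norm_mul, hc, one_mul, Complex.norm_real, Real.norm_eq_abs, sq_abs]

variable [IsScalarTower ℝ A A] [SMulCommClass ℝ A A] [CStarRing A] [CompleteSpace A]
  [StarModule ℝ A]

lemma abs_sum_orthogonal_form_le_add (hn : ∀ a : A, ∃ χ : A →⋆ₙₐ[ℝ] ℂ, ‖χ a‖ = ‖a‖)
    (V : A →L[ℝ] A →L[ℝ] ℝ) (hV : ∀ a c : A, a * c = 0 → V a c = 0)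
    {σ : ℝ} (hσ : σ = 1 ∨ σ = -1) {ι : Type*} (s : Finset ι) (x y : ι → A)
    (hy : ∀ i, star (y i) = σ • y i) {ε : ℝ} (hε : 0 < ε) :
    |∑ i ∈ s, V (x i) (y i)| ≤ 8 * ‖V‖ * ‖∑ i ∈ s, x i * y i‖ + ε * ∑ i ∈ s, ‖V‖ * ‖x i‖ := by
  classical
  obtain ⟨c, hc, hcc, hline⟩ := exists_character_phase (A := A) hσ
  choose a ha using fun (χ : A →⋆ₙₐ[ℝ] ℂ) (i : ι) => hline (y i) (hy i) χ
  -- the density `p = ∑ |y i|²` and the normalisation of the family `y`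
  set p : A := ∑ i ∈ s, star (y i) * y i with hp
  have hpstar : star p = p := by simp [hp, mul_comm]
  have hpval (χ : A →⋆ₙₐ[ℝ] ℂ) : (χ p).re = ∑ i ∈ s, a χ i ^ 2 := by
    simp only [hp, map_sum, character_star_mul_self hc (ha χ _)]
    rw [← Complex.ofReal_sum, Complex.ofReal_re]
  have hmaxpos (t : ℝ) : 0 < max t (ε ^ 2) := lt_max_of_lt_right (by positivity)
  choose f hf using fun i => exists_continuous_functional_mul hn hpstar (y i)
    (F := fun t => 1 / √(max t (ε ^ 2)))
    (continuous_const.div (by fun_prop) fun t => (Real.sqrt_pos.mpr (hmaxpos t)).ne')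
  set b : (A →⋆ₙₐ[ℝ] ℂ) → ι → ℝ := fun χ i => a χ i / √(max (χ p).re (ε ^ 2))
  have hfb (χ : A →⋆ₙₐ[ℝ] ℂ) (i : ι) : χ (f i) = c * (b χ i : ℂ) := by
    rw [hf, ha]; simp only [b]; push_cast; ring
  -- the signed sums and their truncations
  set t : Finset ι → A := fun T => (2 : ℝ) • ∑ i ∈ T, f i - ∑ i ∈ s, f i
  set τ : (A →⋆ₙₐ[ℝ] ℂ) → Finset ι → ℝ := fun χ T => 2 * ∑ i ∈ T, b χ i - ∑ i ∈ s, b χ i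
  have ht (χ : A →⋆ₙₐ[ℝ] ℂ) (T) : χ (t T) = c * (τ χ T : ℂ) := by
    simp only [t, τ, map_sub, map_smul, map_sum, hfb, ← Finset.mul_sum, Complex.real_smul]
    push_cast
    ring
  have hself (a : A) : star (star a * a) = star a * a := by simp [mul_comm]
  choose g hg using fun T => exists_continuous_functional_mul hn (hself (t T)) (t T)
    (F := fun u => 1 / (1 + |u| / 12))
    (continuous_const.div (by fun_prop) fun u => by positivity)
  have hgval (χ : A →⋆ₙₐ[ℝ] ℂ) (T) : χ (g T) = c * ((τ χ T / (1 + τ χ T ^ 2 / 12) : ℝ) : ℂ) := by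
    rw [hg, character_star_mul_self hc (ht χ T), Complex.ofReal_re, ht, abs_of_nonneg (sq_nonneg _)]
    push_cast
    ring
  have hgnorm (T) : ‖g T‖ ≤ 2 := norm_le_of_forall_character hn fun χ => by
    rw [hgval, norm_mul, hc, one_mul, Complex.norm_real]
    exact abs_div_one_add_sq_le _
  set N : ℝ := 2 ^ s.card
  have hN : 0 < N := by positivity
  set w : A := N⁻¹ • ∑ T ∈ s.powerset, star (g T) * g T with hw
  have hwstar : star w = w := by simp [hw, mul_comm]
  set ω : (A →⋆ₙₐ[ℝ] ℂ) → ℝ :=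
    fun χ => N⁻¹ * ∑ T ∈ s.powerset, (τ χ T / (1 + τ χ T ^ 2 / 12)) ^ 2
  have hwval (χ : A →⋆ₙₐ[ℝ] ℂ) : χ w = (ω χ : ℂ) := by
    simp only [hw, ω, map_smul, map_sum, character_star_mul_self hc (hgval χ _),
      Complex.real_smul]
    push_cast
    rfl
  have hω0 (χ : A →⋆ₙₐ[ℝ] ℂ) : 0 ≤ ω χ := by positivity
  have hFc : Continuous fun v : ℝ => 1 / max v (1 / 2) :=
    continuous_const.div (by fun_prop) fun v =>
      (lt_max_of_lt_right (by norm_num : (0 : ℝ) < 1 / 2)).ne'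
  have hmax2 (v : ℝ) : 0 < max v (1 / 2) := lt_max_of_lt_right (by norm_num)
  choose k hk using fun x : A => exists_continuous_functional_mul hn hwstar x hFc
  set u : A := ∑ i ∈ s, x i * y i with hu
  have hku : k u = ∑ i ∈ s, k (y i) * x i := ext_of_forall_character hn fun χ => by
    simp only [hk, hu, map_sum, map_mul, Finset.mul_sum]
    exact Finset.sum_congr rfl fun i _ => by ring
  have hkunorm : ‖k u‖ ≤ 2 * ‖u‖ := norm_le_of_forall_character hn fun χ => by
    rw [hk, norm_mul, Complex.norm_real, Real.norm_eq_abs,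
      abs_of_pos (one_div_pos.mpr (hmax2 _))]
    gcongr
    · rw [div_le_iff₀ (hmax2 _)]
      linarith [le_max_right (χ w).re (1 / 2)]
    · exact norm_character_apply_le χ u
  have hzstar (i : ι) (T) : star (g T * k (y i)) = g T * k (y i) :=
    ext_of_forall_character hn fun χ => by
      have : χ (g T * k (y i)) = c * c * ((τ χ T / (1 + τ χ T ^ 2 / 12) *
          (1 / max (χ w).re (1 / 2) * a χ i) : ℝ) : ℂ) := by
        rw [map_mul, hgval, hk, ha]; push_cast; ring
      rw [map_star, this, Complex.star_def, map_mul, hcc, Complex.conj_ofReal]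
  have hmain : N * ∑ i ∈ s, V (x i) (k (y i) * w) =
      ∑ T ∈ s.powerset, V (g T * k u) (star (g T)) := by
    have h1 (i : ι) : N * V (x i) (k (y i) * w) =
        ∑ T ∈ s.powerset, V (g T * k (y i) * x i) (star (g T)) := by
      have : N • (k (y i) * w) = ∑ T ∈ s.powerset, g T * k (y i) * star (g T) := by
        rw [hw, mul_smul_comm, smul_smul, mul_inv_cancel₀ hN.ne', one_smul, Finset.mul_sum]
        exact Finset.sum_congr rfl fun T _ => by
          rw [mul_comm (star (g T)), ← mul_assoc, mul_comm (k (y i))]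
      rw [← smul_eq_mul, ← map_smul, this, map_sum]
      exact Finset.sum_congr rfl fun T _ =>
        (orthogonal_form_balanced hn V hV (hzstar i T) _ _).symm
    rw [Finset.mul_sum]
    simp only [h1]
    rw [Finset.sum_comm]
    refine Finset.sum_congr rfl fun T _ => ?_
    rw [hku, Finset.mul_sum, map_sum, sum_apply]
    exact Finset.sum_congr rfl fun i _ => by rw [mul_assoc]
  have hbound : |∑ i ∈ s, V (x i) (k (y i) * w)| ≤ 8 * ‖V‖ * ‖u‖ := by
    have h1 : N * |∑ i ∈ s, V (x i) (k (y i) * w)| ≤ N * (8 * ‖V‖ * ‖u‖) := by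
      rw [← abs_of_pos hN, ← abs_mul, abs_of_pos hN, hmain]
      refine (Finset.abs_sum_le_sum_abs _ _).trans ?_
      have h2 (T : Finset ι) : |V (g T * k u) (star (g T))| ≤ 8 * ‖V‖ * ‖u‖ := by
        refine (V.le_opNorm₂ _ _).trans ?_
        rw [norm_star]
        calc ‖V‖ * ‖g T * k u‖ * ‖g T‖ ≤ ‖V‖ * (2 * (2 * ‖u‖)) * 2 := by
              gcongr
              · exact (norm_mul_le _ _).trans (by gcongr; exact hgnorm T)
              · exact hgnorm T
          _ = 8 * ‖V‖ * ‖u‖ := by ring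
      refine (Finset.sum_le_card_nsmul _ _ _ fun T _ => h2 T).trans_eq ?_
      rw [Finset.card_powerset, nsmul_eq_mul]
      push_cast
      rfl
    exact le_of_mul_le_mul_left h1 hN
  have herr (i : ι) (hi : i ∈ s) : ‖y i - k (y i) * w‖ ≤ ε :=
    norm_le_of_forall_character hn fun χ => by
      have hω : (χ w).re = ω χ := by rw [hwval, Complex.ofReal_re]
      have e : χ (y i - k (y i) * w) =
          c * ((a χ i * (1 - ω χ / max (ω χ) (1 / 2)) : ℝ) : ℂ) := by
        rw [map_sub, map_mul, hk, ha, hω, hwval]; push_cast; ring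
      rw [e, norm_mul, hc, one_mul, Complex.norm_real, Real.norm_eq_abs, abs_mul]
      by_cases hlarge : ε ^ 2 ≤ (χ p).re
      · have hb1 : ∑ i ∈ s, b χ i ^ 2 = 1 := by
          have hp0 : 0 < (χ p).re := lt_of_lt_of_le (by positivity) hlarge
          simp only [b, div_pow, max_eq_left hlarge, Real.sq_sqrt hp0.le]
          rw [← Finset.sum_div, ← hpval, div_self hp0.ne']
        have hhalf : 1 / 2 ≤ ω χ := by
          have := half_le_sum_powerset_truncated s (b χ) hb1
          simp only [ω]
          rw [le_inv_mul_iff₀ hN]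
          simp only [N, τ]
          linarith
        rw [max_eq_left hhalf, div_self (by linarith), sub_self, abs_zero, mul_zero]
        exact hε.le
      · have h1 : |a χ i| ≤ ε := by
          refine abs_le_of_sq_le_sq ?_ hε.le
          have := Finset.single_le_sum (f := fun i => a χ i ^ 2) (fun j _ => sq_nonneg _) hi
          rw [← hpval] at this
          exact this.trans (not_le.mp hlarge).le
        have h2 : |1 - ω χ / max (ω χ) (1 / 2)| ≤ 1 := by
          have h3 : ω χ / max (ω χ) (1 / 2) ≤ 1 := div_le_one_of_le₀ (le_max_left _ _) (hmax2 _).le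
          have h4 : 0 ≤ ω χ / max (ω χ) (1 / 2) := div_nonneg (hω0 χ) (hmax2 _).le
          rw [abs_le]; constructor <;> linarith
        exact (mul_le_of_le_one_right (abs_nonneg _) h2).trans h1
  have hsplit : ∑ i ∈ s, V (x i) (y i) =
      ∑ i ∈ s, V (x i) (k (y i) * w) + ∑ i ∈ s, V (x i) (y i - k (y i) * w) := by
    rw [← Finset.sum_add_distrib]
    exact Finset.sum_congr rfl fun i _ => by rw [map_sub]; ring
  have herrsum : |∑ i ∈ s, V (x i) (y i - k (y i) * w)| ≤ ε * ∑ i ∈ s, ‖V‖ * ‖x i‖ := by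
    refine (Finset.abs_sum_le_sum_abs _ _).trans ?_
    rw [Finset.mul_sum]
    refine Finset.sum_le_sum fun i hi => (V.le_opNorm₂ _ _).trans ?_
    rw [mul_comm ε]
    gcongr
    exact herr i hi
  rw [hsplit]
  exact (abs_add_le _ _).trans (add_le_add hbound herrsum)

lemma abs_sum_orthogonal_form_le (hn : ∀ a : A, ∃ χ : A →⋆ₙₐ[ℝ] ℂ, ‖χ a‖ = ‖a‖)
    (V : A →L[ℝ] A →L[ℝ] ℝ) (hV : ∀ a c : A, a * c = 0 → V a c = 0)
    {σ : ℝ} (hσ : σ = 1 ∨ σ = -1) {ι : Type*} (s : Finset ι) (x y : ι → A)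
    (hy : ∀ i, star (y i) = σ • y i) :
    |∑ i ∈ s, V (x i) (y i)| ≤ 8 * ‖V‖ * ‖∑ i ∈ s, x i * y i‖ := by
  set M := ∑ i ∈ s, ‖V‖ * ‖x i‖
  have hM : 0 ≤ M := by positivity
  refine le_of_forall_pos_le_add fun ε hε => ?_
  refine (abs_sum_orthogonal_form_le_add hn V hV hσ s x y hy
    (ε := ε / (M + 1)) (by positivity)).trans ?_
  gcongr
  rw [div_mul_eq_mul_div, div_le_iff₀ (by positivity)]
  nlinarith

end Bound

/-- Helly's theorem: a moment problem with uniformly bounded finite combinations is solvable. -/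
lemma exists_strongDual_apply_eq {E ι : Type*} [NormedAddCommGroup E] [NormedSpace ℝ E]
    (e : ι → E) (v : ι → ℝ) (C : ℝ)
    (h : ∀ r : ι →₀ ℝ, |Finsupp.linearCombination ℝ v r| ≤
      C * ‖Finsupp.linearCombination ℝ e r‖) :
    ∃ φ : E →L[ℝ] ℝ, ∀ i, φ (e i) = v i := by
  set Φ := Finsupp.linearCombination ℝ e
  set Λ := Finsupp.linearCombination ℝ v
  have hker (r : ι →₀ ℝ) (hr : Φ r = 0) : Λ r = 0 := by
    have := h r
    rw [hr, norm_zero, mul_zero] at this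
    exact abs_nonpos_iff.mp this
  obtain ⟨g, hg⟩ :=
    Φ.rangeRestrict.exists_rightInverse_of_surjective (LinearMap.range_rangeRestrict Φ)
  have hΦg (v : LinearMap.range Φ) : Φ (g v) = v :=
    congrArg Subtype.val (LinearMap.congr_fun hg v)
  obtain ⟨φ, hφ, -⟩ := _root_.exists_extension_norm_eq (LinearMap.range Φ)
    ((Λ ∘ₗ g).mkContinuous C fun v => by simpa [hΦg v] using h (g v))
  refine ⟨φ, fun i => ?_⟩
  set r : ι →₀ ℝ := Finsupp.single i 1
  have h1 := hker (g (Φ.rangeRestrict r) - r) (by rw [map_sub, hΦg]; simp)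
  rw [map_sub, sub_eq_zero] at h1
  have h2 := hφ (Φ.rangeRestrict r)
  simp only [LinearMap.mkContinuous_apply, LinearMap.comp_apply, h1] at h2
  simpa [Φ, Λ, r] using h2

lemma exists_functional_of_star_eq {A : Type*} [NonUnitalNormedCommRing A] [StarRing A]
    [CStarRing A] [NormedSpace ℝ A] [IsScalarTower ℝ A A] [SMulCommClass ℝ A A] [CompleteSpace A]
    [StarModule ℝ A] (hn : ∀ a : A, ∃ χ : A →⋆ₙₐ[ℝ] ℂ, ‖χ a‖ = ‖a‖)
    (V : A →L[ℝ] A →L[ℝ] ℝ) (hV : ∀ a c : A, a * c = 0 → V a c = 0)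
    {σ : ℝ} (hσ : σ = 1 ∨ σ = -1) :
    ∃ φ : A →L[ℝ] ℝ, ∀ x y : A, star y = σ • y → V x y = φ (x * y) := by
  obtain ⟨φ, hφ⟩ := exists_strongDual_apply_eq
    (fun q : A × {y : A // star y = σ • y} => q.1 * (q.2 : A))
    (fun q => V q.1 q.2) (8 * ‖V‖) (fun r => by
      have := abs_sum_orthogonal_form_le hn V hV hσ r.support (fun q => r q • q.1)
        (fun q => (q.2 : A)) (fun q => q.2.2)
      simpa [Finsupp.linearCombination_apply, Finsupp.sum, smul_mul_assoc] using this)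
  exact ⟨φ, fun x y hy => (hφ (x, ⟨y, hy⟩)).symm⟩

/-- Let `A` be a commutative real C*-algebra (a real commutative Banach
*-algebra satisfying the C*-identity and such that `1 + a*a` is invertible in the unitization
for every `a`), and let `V : A × A → ℝ` be a bounded real-bilinear orthogonal form (i.e.
`V a b* = 0` whenever `a b* = b* a = 0`).  Then there exist bounded real-linear functionals
`φ₁, φ₂` on `A` with `V x y = φ₁ (x y) + φ₂ (x y*)` for all `x, y ∈ A`. -/
theorem stmt_0 {A : Type*} [NonUnitalNormedCommRing A] [StarRing A] [CStarRing A]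
    [NormedSpace ℝ A] [IsScalarTower ℝ A A] [SMulCommClass ℝ A A] [CompleteSpace A]
    [StarModule ℝ A]
    (hA : ∀ a : A, IsUnit ((1 : Unitization ℝ A) +
      star (Unitization.inr a : Unitization ℝ A) * (Unitization.inr a : Unitization ℝ A)))
    (V : A →L[ℝ] A →L[ℝ] ℝ)
    (hV : ∀ a b : A, a * star b = 0 → star b * a = 0 → V a (star b) = 0) :
    ∃ φ₁ φ₂ : A →L[ℝ] ℝ, ∀ x y : A, V x y = φ₁ (x * y) + φ₂ (x * star y) := by
  have hn := exists_character_norm_eq hA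
  have hV' (a c : A) (h : a * c = 0) : V a c = 0 := by
    have := hV a (star c)
    rw [star_star] at this
    exact this h (by rwa [mul_comm])
  obtain ⟨f, hf⟩ := exists_functional_of_star_eq hn V hV' (Or.inl rfl)
  obtain ⟨g, hg⟩ := exists_functional_of_star_eq hn V hV' (Or.inr rfl)
  refine ⟨(1 / 2 : ℝ) • (f + g), (1 / 2 : ℝ) • (f - g), fun x y => ?_⟩
  have h1 := hf x (y + star y) (by simp [add_comm])
  have h2 := hg x (y - star y) (by simp)
  rw [map_add, mul_add, map_add] at h1
  rw [map_sub, mul_sub, map_sub] at h2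
  simp only [smul_apply, add_apply, sub_apply, smul_eq_mul]
  linarith
end

section
/- Let A be a unital real C*-algebra with unit 1, and let V : A × A → ℝ be a bounded, symmetric (V(x,y) = V(y,x) for all x,y), real-bilinear orthogonal form. Define φ₁ : A → ℝ by φ₁(x) = V(x, 1). Then V(a, b) = φ₁((ab + ba)/2) for every pair of self-adjoint elements a, b ∈ A (i.e., a* = a and b* = b). -/
open Polynomial Filter Topology

section Representation

variable {A : Type*} [NormedRing A] [NormedAlgebra ℝ A]

variable (A) in
/-- The bounded complex-linear operators on the complexification of the dual space. -/
def ComplexDualEnd : Type _ := (A →L[ℝ] ℂ) →L[ℂ] (A →L[ℝ] ℂ)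

namespace ComplexDualEnd

noncomputable instance : NormedRing (ComplexDualEnd A) :=
  inferInstanceAs (NormedRing ((A →L[ℝ] ℂ) →L[ℂ] (A →L[ℝ] ℂ)))

noncomputable instance : NormedAlgebra ℂ (ComplexDualEnd A) :=
  inferInstanceAs (NormedAlgebra ℂ ((A →L[ℝ] ℂ) →L[ℂ] (A →L[ℝ] ℂ)))

instance : CompleteSpace (ComplexDualEnd A) :=
  inferInstanceAs (CompleteSpace ((A →L[ℝ] ℂ) →L[ℂ] (A →L[ℝ] ℂ)))

end ComplexDualEnd

/-- Precomposition with right multiplication by an element, as an operator on the complexification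
of the dual space. -/
noncomputable def complexDualMulRight (b : A) : (A →L[ℝ] ℂ) →L[ℂ] (A →L[ℝ] ℂ) :=
  LinearMap.mkContinuous
    { toFun := fun f => f.comp ((ContinuousLinearMap.mul ℝ A).flip b)
      map_add' := fun f g => by ext; simp
      map_smul' := fun z f => by ext; simp } ‖b‖ fun f => by
        refine ContinuousLinearMap.opNorm_le_bound _ (by positivity) fun x => ?_
        calc ‖f (x * b)‖ ≤ ‖f‖ * ‖x * b‖ := f.le_opNorm _
          _ ≤ ‖f‖ * (‖x‖ * ‖b‖) := by gcongr; exact norm_mul_le _ _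
          _ = ‖b‖ * ‖f‖ * ‖x‖ := by ring

@[simp]
theorem complexDualMulRight_apply (b : A) (f : A →L[ℝ] ℂ) (x : A) :
    complexDualMulRight b f x = f (x * b) := rfl

theorem norm_complexDualMulRight_le (b : A) : ‖complexDualMulRight b‖ ≤ ‖b‖ :=
  LinearMap.mkContinuous_norm_le _ (norm_nonneg b) _

theorem norm_le_norm_complexDualMulRight [NormOneClass A] (b : A) :
    ‖b‖ ≤ ‖complexDualMulRight b‖ := by
  obtain ⟨g, hg, hgb⟩ := exists_dual_vector'' ℝ b
  have hf : ‖Complex.ofRealCLM.comp g‖ ≤ 1 :=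
    ContinuousLinearMap.opNorm_le_bound _ zero_le_one fun x => by
      simpa using (g.le_opNorm x).trans (mul_le_mul_of_nonneg_right hg (norm_nonneg x))
  calc ‖b‖ = ‖complexDualMulRight b (Complex.ofRealCLM.comp g) 1‖ := by simp [hgb]
    _ ≤ ‖complexDualMulRight b (Complex.ofRealCLM.comp g)‖ * ‖(1 : A)‖ :=
      ContinuousLinearMap.le_opNorm _ _
    _ ≤ ‖complexDualMulRight b‖ * ‖Complex.ofRealCLM.comp g‖ * ‖(1 : A)‖ := by
      gcongr; exact ContinuousLinearMap.le_opNorm _ _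
    _ ≤ ‖complexDualMulRight b‖ * 1 * ‖(1 : A)‖ := by gcongr
    _ = ‖complexDualMulRight b‖ := by simp

/-- A real normed algebra acts by bounded complex-linear operators on the complexification of its
dual space, through right multiplication in the argument. -/
noncomputable def complexDualRep : A →+* ComplexDualEnd A where
  toFun := complexDualMulRight
  map_one' := ContinuousLinearMap.ext fun f => ContinuousLinearMap.ext fun x =>
    congrArg f (mul_one x)
  map_mul' b c := ContinuousLinearMap.ext fun f => ContinuousLinearMap.ext fun x =>
    congrArg f (mul_assoc x b c).symm
  map_zero' := ContinuousLinearMap.ext fun f => ContinuousLinearMap.ext fun x =>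
    (congrArg f (mul_zero x)).trans (map_zero f)
  map_add' b c := ContinuousLinearMap.ext fun f => ContinuousLinearMap.ext fun x =>
    (congrArg f (mul_add x b c)).trans (map_add f _ _)

theorem complexDualRep_algebraMap (r : ℝ) :
    complexDualRep (algebraMap ℝ A r) = algebraMap ℂ (ComplexDualEnd A) r := by
  rw [Algebra.algebraMap_eq_smul_one (R := ℂ)]
  refine ContinuousLinearMap.ext fun f => ContinuousLinearMap.ext fun x => ?_
  change f (x * algebraMap ℝ A r) = (r : ℂ) * f x
  rw [← Algebra.commutes, ← Algebra.smul_def, map_smul, Complex.real_smul]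

theorem norm_complexDualRep [NormOneClass A] (b : A) : ‖complexDualRep b‖ = ‖b‖ :=
  (norm_complexDualMulRight_le b).antisymm (norm_le_norm_complexDualMulRight b)

end Representation

section Spectrum

variable {A D : Type*} [NormedRing A] [NormedRing D] [NormedAlgebra ℂ D] {π : A →+* D}

theorem map_aeval_eq_aeval_map [NormedAlgebra ℝ A]
    (hπ : ∀ r : ℝ, π (algebraMap ℝ A r) = algebraMap ℂ D r)
    (a : A) (p : ℝ[X]) :
    π (aeval a p) = aeval (π a) (p.map Complex.ofRealHom) := by
  rw [aeval_def, aeval_def, hom_eval₂, eval₂_map]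
  congr 1
  ext1 r
  exact hπ r

theorem IsSelfAdjoint.spectralRadius_map [StarRing A] [CStarRing A] [CompleteSpace D]
    (hnorm : ∀ b, ‖π b‖ = ‖b‖) {b : A} (hb : IsSelfAdjoint b) :
    spectralRadius ℂ (π b) = ‖b‖₊ := by
  have hlim := (spectrum.pow_nnnorm_pow_one_div_tendsto_nhds_spectralRadius
    (π b)).comp (tendsto_pow_atTop_atTop_of_one_lt (one_lt_two (α := ℕ)))
  refine tendsto_nhds_unique hlim ?_
  refine tendsto_const_nhds.congr fun n => ?_
  have h : ‖π b ^ 2 ^ n‖₊ = ‖b‖₊ ^ 2 ^ n := by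
    rw [← map_pow, ← hb.nnnorm_pow_two_pow]
    exact NNReal.eq (hnorm _)
  simp only [Function.comp_apply, h]
  rw [ENNReal.coe_pow, ← ENNReal.rpow_natCast, ← ENNReal.rpow_mul]
  simp

theorem notMem_spectrum_of_isUnit_sq_add_sq {T : D} {z : ℂ}
    (h : IsUnit ((T - algebraMap ℂ D z.re) ^ 2 + algebraMap ℂ D (z.im ^ 2))) :
    z ∉ spectrum ℂ T := by
  set S := T - algebraMap ℂ D z.re
  set j := algebraMap ℂ D (z.im * Complex.I)
  have hj : j * S = S * j := Algebra.commutes _ S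
  have hjj : j * j = -algebraMap ℂ D (z.im ^ 2) := by
    rw [← map_mul, ← map_neg]; congr 1; ring_nf; simp
  have hz : algebraMap ℂ D z - T = j - S := by
    conv_lhs => rw [← Complex.re_add_im z, map_add]
    simp only [j, S]; abel
  have hcomm : Commute (j - S) (-j - S) := by
    simp only [commute_iff_eq, mul_sub, sub_mul, mul_neg, neg_mul, hj]; abel
  have hfac : (j - S) * (-j - S) = S ^ 2 + algebraMap ℂ D (z.im ^ 2) := by
    simp only [mul_sub, sub_mul, mul_neg, hj, hjj, sq]; abel
  rw [← hfac] at h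
  rw [spectrum.notMem_iff, hz]
  exact (hcomm.isUnit_mul_iff.mp h).1

variable [StarRing A] [NormedAlgebra ℝ A] [StarModule ℝ A]

theorem IsSelfAdjoint.isUnit_sub_sq_add (hA : ∀ a : A, IsUnit (1 + star a * a)) {b : A}
    (hb : IsSelfAdjoint b) (x : ℝ) {y : ℝ} (hy : y ≠ 0) :
    IsUnit ((b - algebraMap ℝ A x) ^ 2 + algebraMap ℝ A (y ^ 2)) := by
  have hc : IsSelfAdjoint (y⁻¹ • (b - algebraMap ℝ A x)) :=
    (IsSelfAdjoint.all y⁻¹).smul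
      (hb.sub (by rw [Algebra.algebraMap_eq_smul_one]; exact (IsSelfAdjoint.all x).smul (.one A)))
  have h := hA (y⁻¹ • (b - algebraMap ℝ A x))
  rw [hc.star_eq] at h
  have h2 := ((IsUnit.mk0 (y ^ 2) (pow_ne_zero 2 hy)).map (algebraMap ℝ A)).mul h
  convert h2 using 1
  rw [← Algebra.smul_def, smul_mul_smul_comm, smul_add, smul_smul, add_comm, ← sq,
    Algebra.algebraMap_eq_smul_one]
  congr 1
  rw [← sq, show y ^ 2 * y⁻¹ ^ 2 = 1 by field_simp, one_smul]

theorem IsSelfAdjoint.im_eq_zero_of_mem_spectrum_map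
    (hπ : ∀ r : ℝ, π (algebraMap ℝ A r) = algebraMap ℂ D r)
    (hA : ∀ a : A, IsUnit (1 + star a * a)) {b : A} (hb : IsSelfAdjoint b) {z : ℂ}
    (hz : z ∈ spectrum ℂ (π b)) : z.im = 0 := by
  by_contra hy
  have h := (hb.isUnit_sub_sq_add hA z.re hy).map π
  rw [map_add, map_pow, map_sub, hπ, hπ, Complex.ofReal_pow] at h
  exact notMem_spectrum_of_isUnit_sq_add_sq h hz

theorem IsSelfAdjoint.norm_aeval_le_of_map [CStarRing A] [NormOneClass D] [CompleteSpace D]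
    (hnorm : ∀ b, ‖π b‖ = ‖b‖) (hπ : ∀ r : ℝ, π (algebraMap ℝ A r) = algebraMap ℂ D r)
    (hA : ∀ a : A, IsUnit (1 + star a * a)) {a : A}
    (ha : IsSelfAdjoint a) (p : ℝ[X]) {C : ℝ} (hC : 0 ≤ C) {R : ℝ} (hR : ‖a‖ ≤ R)
    (hp : ∀ t ∈ Set.Icc (-R) R, |p.eval t| ≤ C) : ‖aeval a p‖ ≤ C := by
  have hsa : IsSelfAdjoint (aeval a p) := by
    rw [isSelfAdjoint_iff, aeval_eq_sum_range, star_sum]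
    simp [ha.star_eq]
  have : Nontrivial D := NormOneClass.nontrivial
  have hle : spectralRadius ℂ (π (aeval a p)) ≤ C.toNNReal := by
    refine iSup₂_le fun w hw => ?_
    rw [map_aeval_eq_aeval_map hπ, spectrum.map_polynomial_aeval] at hw
    obtain ⟨z, hz, rfl⟩ := hw
    have him := ha.im_eq_zero_of_mem_spectrum_map hπ hA hz
    obtain ⟨t, rfl⟩ : ∃ t : ℝ, z = t := ⟨z.re, Complex.ext rfl (by simpa using him)⟩
    have ht : |t| ≤ R := by
      have := spectrum.norm_le_norm_of_mem hz
      rw [hnorm, Complex.norm_real, Real.norm_eq_abs] at this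
      exact this.trans hR
    have heval : eval (t : ℂ) (p.map Complex.ofRealHom) = ((p.eval t : ℝ) : ℂ) := by
      rw [← Complex.ofRealHom_eq_coe, eval_map_apply]; rfl
    rw [ENNReal.coe_le_coe, ← NNReal.coe_le_coe, Real.coe_toNNReal _ hC, coe_nnnorm]
    dsimp only
    rw [heval, Complex.norm_real]
    exact hp t (abs_le.mp ht)
  rw [hsa.spectralRadius_map hnorm, ENNReal.coe_le_coe, ← NNReal.coe_le_coe,
    Real.coe_toNNReal _ hC, coe_nnnorm] at hle
  exact hle

/-- A polynomial in a self-adjoint element of a real C⋆-algebra is bounded in norm by its supremum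
on the interval `[-R, R]`, when `‖a‖ ≤ R`. -/
theorem IsSelfAdjoint.norm_aeval_le [CStarRing A] (hA : ∀ a : A, IsUnit (1 + star a * a)) {a : A}
    (ha : IsSelfAdjoint a) (p : ℝ[X]) {C : ℝ} (hC : 0 ≤ C) {R : ℝ} (hR : ‖a‖ ≤ R)
    (hp : ∀ t ∈ Set.Icc (-R) R, |p.eval t| ≤ C) : ‖aeval a p‖ ≤ C := by
  rcases subsingleton_or_nontrivial A with _ | _
  · simpa [Subsingleton.elim (aeval a p) 0] using hC
  have : NormOneClass A := ⟨CStarRing.norm_one⟩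
  have : NormOneClass (ComplexDualEnd A) :=
    ⟨by rw [← map_one (complexDualRep (A := A)), norm_complexDualRep, norm_one]⟩
  exact ha.norm_aeval_le_of_map norm_complexDualRep
    complexDualRep_algebraMap hA p hC hR hp

end Spectrum

section Tent

/-- The piecewise linear bump function supported in `[-1, 1]` with value `1` at `0`. -/
noncomputable def tent (t : ℝ) : ℝ := max 0 (1 - |t|)

theorem continuous_tent : Continuous tent := by
  unfold tent; fun_prop

theorem tent_nonneg (t : ℝ) : 0 ≤ tent t := le_max_left _ _

theorem tent_le_one (t : ℝ) : tent t ≤ 1 :=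
  max_le zero_le_one (by linarith [abs_nonneg t])

theorem tent_of_one_le_abs {t : ℝ} (ht : 1 ≤ |t|) : tent t = 0 :=
  max_eq_left (by linarith)

theorem tent_of_abs_le_one {t : ℝ} (ht : |t| ≤ 1) : tent t = 1 - |t| :=
  max_eq_right (by linarith)

theorem tent_sub_mul_tent_sub (t : ℝ) {i j : ℤ} (hij : 2 ≤ |i - j|) :
    tent (t - i) * tent (t - j) = 0 := by
  by_contra h
  obtain ⟨hi, hj⟩ := mul_ne_zero_iff.mp h
  have hi' : |t - i| < 1 := not_le.mp (mt tent_of_one_le_abs hi)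
  have hj' : |t - j| < 1 := not_le.mp (mt tent_of_one_le_abs hj)
  have hij' : (2 : ℝ) ≤ |(i : ℝ) - j| := by exact_mod_cast hij
  have := abs_sub_le (i : ℝ) t j
  rw [abs_sub_comm (i : ℝ) t] at this
  linarith

theorem sum_mul_tent_sub {t : ℝ} {S : Finset ℤ} (h₀ : ⌊t⌋ ∈ S) (h₁ : ⌊t⌋ + 1 ∈ S) (c : ℤ → ℝ) :
    ∑ i ∈ S, c i * tent (t - i) = c ⌊t⌋ * (1 - Int.fract t) + c (⌊t⌋ + 1) * Int.fract t := by
  have hfr₀ := Int.fract_nonneg t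
  have hfr₁ := Int.fract_lt_one t
  have ht : (⌊t⌋ : ℝ) + Int.fract t = t := Int.floor_add_fract t
  have hsub : ({⌊t⌋, ⌊t⌋ + 1} : Finset ℤ) ⊆ S := by
    simp [Finset.insert_subset_iff, h₀, h₁]
  rw [← Finset.sum_subset hsub, Finset.sum_pair (by simp)]
  · have e₀ : t - (⌊t⌋ : ℝ) = Int.fract t := rfl
    have e₁ : t - ((⌊t⌋ + 1 : ℤ) : ℝ) = -(1 - Int.fract t) := by push_cast; linarith
    have a₁ : |1 - Int.fract t| = 1 - Int.fract t := abs_of_nonneg (by linarith)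
    rw [e₀, e₁, tent_of_abs_le_one (by rw [abs_of_nonneg hfr₀]; exact hfr₁.le),
      tent_of_abs_le_one (by rw [abs_neg, a₁]; linarith), abs_of_nonneg hfr₀, abs_neg, a₁]
    ring
  · intro i _ hi
    simp only [Finset.mem_insert, Finset.mem_singleton, not_or] at hi
    rw [tent_of_one_le_abs, mul_zero]
    rcases lt_or_gt_of_ne hi.1 with h | h
    · have : (i : ℝ) + 1 ≤ ⌊t⌋ := by exact_mod_cast h
      exact le_abs.mpr (.inl (by linarith))
    · have : (⌊t⌋ : ℝ) + 2 ≤ i := by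
        have : ⌊t⌋ + 2 ≤ i := by have := hi.2; omega
        exact_mod_cast this
      exact le_abs.mpr (.inr (by linarith))

end Tent

section OrthogonalForm

theorem abs_sum_sub_sq_mul_le (S : Finset ℤ) (u : ℤ → ℤ → ℝ) {M : ℝ}
    (hM : ∀ i j, |u i j| ≤ M) (hu : ∀ i j, 2 ≤ |i - j| → u i j = 0) :
    |∑ i ∈ S, ∑ j ∈ S, ((i : ℝ) - j) ^ 2 * u i j| ≤ S.card * (3 * M) := by
  have hM0 : 0 ≤ M := (abs_nonneg _).trans (hM 0 0)
  have key (i j : ℤ) :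
      |((i : ℝ) - j) ^ 2 * u i j| ≤ if j ∈ Finset.Icc (i - 1) (i + 1) then M else 0 := by
    split_ifs with h
    · rw [Finset.mem_Icc] at h
      have h1 : |(i : ℝ) - j| ≤ 1 := by
        have : |i - j| ≤ 1 := abs_le.mpr ⟨by omega, by omega⟩
        exact_mod_cast this
      have h2 : ((i : ℝ) - j) ^ 2 ≤ 1 := (sq_le_one_iff_abs_le_one _).mpr h1
      rw [abs_mul, abs_of_nonneg (sq_nonneg _)]
      exact (mul_le_mul h2 (hM i j) (abs_nonneg _) zero_le_one).trans_eq (one_mul M)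
    · rw [hu, mul_zero, abs_zero]
      rw [Finset.mem_Icc, not_and_or] at h
      rw [le_abs]
      omega
  calc |∑ i ∈ S, ∑ j ∈ S, ((i : ℝ) - j) ^ 2 * u i j|
      ≤ ∑ i ∈ S, ∑ j ∈ S, |((i : ℝ) - j) ^ 2 * u i j| :=
        (Finset.abs_sum_le_sum_abs _ _).trans
          (Finset.sum_le_sum fun i _ => Finset.abs_sum_le_sum_abs _ _)
    _ ≤ ∑ i ∈ S, 3 * M := by
        refine Finset.sum_le_sum fun i _ => ?_
        refine (Finset.sum_le_sum fun j _ => key i j).trans ?_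
        rw [← Finset.sum_filter, Finset.sum_const, nsmul_eq_mul]
        gcongr
        have : (S.filter (· ∈ Finset.Icc (i - 1) (i + 1))).card ≤ 3 :=
          (Finset.card_le_card (t := Finset.Icc (i - 1) (i + 1))
            fun j hj => (Finset.mem_filter.mp hj).2).trans_eq (by rw [Int.card_Icc]; omega)
        exact_mod_cast this
    _ = S.card * (3 * M) := by rw [Finset.sum_const, nsmul_eq_mul]

theorem two_mul_apply_sum_smul_sub {E : Type*} [AddCommGroup E] [Module ℝ E]
    (U : E →ₗ[ℝ] E →ₗ[ℝ] ℝ) (hsym : ∀ x y, U x y = U y x) (S : Finset ℤ) (h : ℤ → E) :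
    2 * (U (∑ i ∈ S, (i : ℝ) • h i) (∑ i ∈ S, (i : ℝ) • h i) -
      U (∑ i ∈ S, h i) (∑ i ∈ S, (i : ℝ) ^ 2 • h i)) =
      -∑ i ∈ S, ∑ j ∈ S, ((i : ℝ) - j) ^ 2 * U (h i) (h j) := by
  have e₁ : U (∑ i ∈ S, (i : ℝ) • h i) (∑ i ∈ S, (i : ℝ) • h i) =
      ∑ i ∈ S, ∑ j ∈ S, (i : ℝ) * j * U (h i) (h j) := by
    simp only [map_sum, map_smul, LinearMap.sum_apply, LinearMap.smul_apply, smul_eq_mul,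
      Finset.mul_sum, mul_assoc]
    rw [Finset.sum_comm]
    exact Finset.sum_congr rfl fun i _ => Finset.sum_congr rfl fun j _ => mul_left_comm _ _ _
  have e₂ : U (∑ i ∈ S, h i) (∑ i ∈ S, (i : ℝ) ^ 2 • h i) =
      ∑ i ∈ S, ∑ j ∈ S, (j : ℝ) ^ 2 * U (h i) (h j) := by
    rw [map_sum U, LinearMap.sum_apply]
    simp only [map_sum, map_smul, smul_eq_mul]
  have e₃ : U (∑ i ∈ S, h i) (∑ i ∈ S, (i : ℝ) ^ 2 • h i) =
      ∑ i ∈ S, ∑ j ∈ S, (i : ℝ) ^ 2 * U (h i) (h j) := by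
    rw [e₂, Finset.sum_comm]
    simp_rw [hsym]
  have e₄ : ∑ i ∈ S, ∑ j ∈ S, ((i : ℝ) - j) ^ 2 * U (h i) (h j) =
      ∑ i ∈ S, ∑ j ∈ S, (i : ℝ) ^ 2 * U (h i) (h j) +
        ∑ i ∈ S, ∑ j ∈ S, (j : ℝ) ^ 2 * U (h i) (h j) -
          2 * ∑ i ∈ S, ∑ j ∈ S, (i : ℝ) * j * U (h i) (h j) := by
    simp only [Finset.mul_sum, ← Finset.sum_add_distrib, ← Finset.sum_sub_distrib]
    exact Finset.sum_congr rfl fun i _ => Finset.sum_congr rfl fun j _ => by ring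
  rw [e₄, ← e₁, ← e₂, ← e₃]
  ring

/-- An orthogonal symmetric bounded bilinear form on `C(K, ℝ)` satisfies `U f f = U 1 (f * f)`. -/
theorem ContinuousMap.apply_self_eq_of_orthogonal {K : Type*} [TopologicalSpace K] [CompactSpace K]
    (U : C(K, ℝ) →ₗ[ℝ] C(K, ℝ) →ₗ[ℝ] ℝ) {M : ℝ} (hM : 0 ≤ M)
    (hbdd : ∀ f g, |U f g| ≤ M * ‖f‖ * ‖g‖) (hsym : ∀ f g, U f g = U g f)
    (horth : ∀ f g, f * g = 0 → U f g = 0) (f : C(K, ℝ)) : U f f = U 1 (f * f) := by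
  have hU (g₁ g₂ : C(K, ℝ)) (h₁ : ‖g₁‖ ≤ 1) (h₂ : ‖g₂‖ ≤ 1) : |U g₁ g₂| ≤ M :=
    calc |U g₁ g₂| ≤ M * ‖g₁‖ * ‖g₂‖ := hbdd g₁ g₂
      _ ≤ M * 1 * 1 := by gcongr
      _ = M := by ring
  have hbound (n : ℕ) : (n : ℝ) ^ 2 * |U f f - U 1 (f * f)| ≤ (3 * (n * ‖f‖) + 6) * M := by
    set N : ℤ := ⌊(n : ℝ) * ‖f‖⌋
    have hN0 : 0 ≤ N := Int.floor_nonneg.mpr (by positivity)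
    set S : Finset ℤ := Finset.Icc (-N - 1) (N + 1)
    have hmem (x : K) : ⌊n * f x⌋ ∈ S ∧ ⌊n * f x⌋ + 1 ∈ S := by
      have hx := abs_le.mp (f.norm_coe_le_norm x)
      have h1 : ⌊n * f x⌋ ≤ N := by
        apply Int.floor_le_floor; gcongr; exact hx.2
      have h2 : -N - 1 ≤ ⌊n * f x⌋ := by
        rw [Int.le_floor]; push_cast
        have := Int.lt_floor_add_one ((n : ℝ) * ‖f‖)
        have := mul_le_mul_of_nonneg_left hx.1 (Nat.cast_nonneg (α := ℝ) n)
        linarith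
      simp only [S, Finset.mem_Icc]
      omega
    set h : ℤ → C(K, ℝ) := fun i =>
      ⟨fun x => tent (n * f x - i), continuous_tent.comp (by fun_prop)⟩
    have hh (i : ℤ) : ‖h i‖ ≤ 1 := (ContinuousMap.norm_le _ zero_le_one).mpr fun x => by
      simpa [h, abs_of_nonneg (tent_nonneg _)] using tent_le_one _
    have hsum (c : ℤ → ℝ) (x : K) : (∑ i ∈ S, c i • h i) x =
        c ⌊n * f x⌋ * (1 - Int.fract (n * f x)) + c (⌊n * f x⌋ + 1) * Int.fract (n * f x) := by
      rw [← sum_mul_tent_sub (hmem x).1 (hmem x).2]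
      simp [ContinuousMap.sum_apply, h]
    have hone : ∑ i ∈ S, h i = 1 := by
      ext x
      simpa using hsum (fun _ => 1) x
    have hid : ∑ i ∈ S, (i : ℝ) • h i = (n : ℝ) • f := by
      ext x
      rw [hsum (fun i => (i : ℝ)) x]
      have := Int.floor_add_fract (n * f x)
      simp only [ContinuousMap.smul_apply, smul_eq_mul]
      push_cast
      linarith
    have hsq : ‖(∑ i ∈ S, (i : ℝ) ^ 2 • h i) - ((n : ℝ) • f) * ((n : ℝ) • f)‖ ≤ 1 := by
      refine (ContinuousMap.norm_le _ zero_le_one).mpr fun x => ?_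
      rw [ContinuousMap.sub_apply, hsum (fun i => (i : ℝ) ^ 2) x]
      simp only [ContinuousMap.mul_apply, ContinuousMap.smul_apply, smul_eq_mul]
      have h0 := Int.fract_nonneg (n * f x)
      have h1 := Int.fract_lt_one (n * f x)
      rw [← Int.floor_add_fract (n * f x), Int.fract_intCast_add, Int.fract_fract,
        Int.floor_intCast_add, Int.floor_fract, add_zero]
      push_cast
      rw [Real.norm_eq_abs, abs_le]
      constructor <;> nlinarith
    have h2 := two_mul_apply_sum_smul_sub U hsym S h
    have h3 := abs_sum_sub_sq_mul_le S (fun i j => U (h i) (h j))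
      (fun i j => hU _ _ (hh i) (hh j)) fun i j hij => horth _ _ <| by
        ext x; exact tent_sub_mul_tent_sub _ hij
    rw [← abs_neg, ← h2, hone, hid] at h3
    have hone_norm : ‖(1 : C(K, ℝ))‖ ≤ 1 :=
      (ContinuousMap.norm_le _ zero_le_one).mpr fun x => by simp
    have h4 := hU 1 _ hone_norm hsq
    rw [map_sub] at h4
    have hS : (S.card : ℝ) ≤ 2 * (n * ‖f‖) + 3 := by
      have e : ((S.card : ℤ) : ℝ) = 2 * N + 3 := by
        rw [Int.card_Icc, Int.toNat_of_nonneg (by omega)]; push_cast; ring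
      have := Int.floor_le ((n : ℝ) * ‖f‖)
      rw [← Int.cast_natCast, e]
      linarith
    have h5 : (S.card : ℝ) * (3 * M) ≤ (2 * (n * ‖f‖) + 3) * (3 * M) := by gcongr
    have e6 : U ((n : ℝ) • f) ((n : ℝ) • f) - U 1 (((n : ℝ) • f) * ((n : ℝ) • f)) =
        (n : ℝ) ^ 2 * (U f f - U 1 (f * f)) := by
      rw [smul_mul_smul_comm]; simp; ring
    rw [← abs_of_nonneg (sq_nonneg (n : ℝ)), ← abs_mul, ← e6]
    rw [abs_mul, abs_two] at h3
    have h7 := abs_sub_le (U ((n : ℝ) • f) ((n : ℝ) • f)) (U 1 (∑ i ∈ S, (i : ℝ) ^ 2 • h i))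
      (U 1 (((n : ℝ) • f) * ((n : ℝ) • f)))
    linarith
  by_contra hne
  have hpos : 0 < |U f f - U 1 (f * f)| := abs_pos.mpr (sub_ne_zero.mpr hne)
  set δ := |U f f - U 1 (f * f)|
  obtain ⟨n, hn⟩ := exists_nat_gt ((3 * ‖f‖ + 6) * M / δ)
  rw [div_lt_iff₀ hpos] at hn
  have hn1 : (1 : ℝ) ≤ n := by
    have h0 : (0 : ℝ) < n := by
      by_contra h
      have : (n : ℝ) * δ ≤ 0 := mul_nonpos_of_nonpos_of_nonneg (not_lt.mp h) hpos.le
      have : 0 ≤ (3 * ‖f‖ + 6) * M := by positivity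
      linarith
    exact_mod_cast h0
  have h1 := hbound n
  have h2 : (3 * (n * ‖f‖) + 6) * M ≤ n * ((3 * ‖f‖ + 6) * M) := by
    rw [← mul_assoc (n : ℝ)]
    refine mul_le_mul_of_nonneg_right ?_ hM
    linarith
  have h3 : (n : ℝ) * ((3 * ‖f‖ + 6) * M) < n * (n * δ) := by gcongr
  linarith

end OrthogonalForm

section FunctionalCalculus

/-- A contractive algebra homomorphism extends along a homomorphism with dense range. -/
theorem AlgHom.exists_extension_of_norm_le {P B A : Type*} [Ring P] [Algebra ℝ P]
    [NormedRing B] [NormedAlgebra ℝ B] [NormedRing A] [NormedAlgebra ℝ A] [CompleteSpace A]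
    (φ : P →ₐ[ℝ] A) (e : P →ₐ[ℝ] B) (hdense : DenseRange e) (hnorm : ∀ p, ‖φ p‖ ≤ ‖e p‖) :
    ∃ Φ : B →ₐ[ℝ] A, (∀ b, ‖Φ b‖ ≤ ‖b‖) ∧ ∀ p, Φ (e p) = φ p := by
  have hnorm' (p : P) : ‖φ.toLinearMap p‖ ≤ 1 * ‖e.toLinearMap p‖ :=
    (hnorm p).trans_eq (one_mul _).symm
  let Φ := φ.toLinearMap.extendOfNorm e.toLinearMap
  have hΦ (p : P) : Φ (e p) = φ p :=
    LinearMap.extendOfNorm_eq (f := φ.toLinearMap) (e := e.toLinearMap) hdense ⟨1, hnorm'⟩ p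
  have hone : Φ 1 = 1 := by rw [← map_one e, hΦ, map_one]
  have hmul (x y : B) : Φ (x * y) = Φ x * Φ y := by
    refine hdense.induction_on₂ (isClosed_eq (by fun_prop) (by fun_prop)) (fun p q => ?_) x y
    rw [← map_mul, hΦ, hΦ, hΦ, map_mul]
  exact ⟨AlgHom.ofLinearMap Φ.toLinearMap hone hmul, fun b =>
    (LinearMap.norm_extendOfNorm_apply_le hdense 1 hnorm' b).trans_eq (one_mul _), hΦ⟩

/-- Continuous functional calculus for a self-adjoint element of a real C⋆-algebra. -/
theorem IsSelfAdjoint.exists_continuousMap_algHom {A : Type*} [NormedRing A] [StarRing A]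
    [CStarRing A] [NormedAlgebra ℝ A] [CompleteSpace A] [StarModule ℝ A]
    (hA : ∀ a : A, IsUnit (1 + star a * a)) {a : A} (ha : IsSelfAdjoint a) :
    ∃ Φ : C(Set.Icc (-‖a‖) ‖a‖, ℝ) →ₐ[ℝ] A, (∀ f, ‖Φ f‖ ≤ ‖f‖) ∧ ∃ f, Φ f = a := by
  let e : ℝ[X] →ₐ[ℝ] C(Set.Icc (-‖a‖) ‖a‖, ℝ) := Polynomial.toContinuousMapOnAlgHom _
  have hdense : DenseRange e := by
    have h := polynomialFunctions_closure_eq_top (-‖a‖) ‖a‖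
    intro g
    have hg : g ∈ (polynomialFunctions (Set.Icc (-‖a‖) ‖a‖)).topologicalClosure := h ▸ trivial
    rw [← SetLike.mem_coe, Subalgebra.topologicalClosure_coe, polynomialFunctions_coe] at hg
    exact hg
  obtain ⟨Φ, hΦ, hΦe⟩ := (aeval a).exists_extension_of_norm_le e hdense fun p =>
    ha.norm_aeval_le hA p (norm_nonneg _) le_rfl fun t ht => (e p).norm_coe_le_norm ⟨t, ht⟩
  exact ⟨Φ, hΦ, e X, by rw [hΦe, aeval_X]⟩

end FunctionalCalculus

theorem IsSelfAdjoint.apply_self_of_orthogonal {A : Type*} [NormedRing A] [StarRing A]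
    [CStarRing A] [NormedAlgebra ℝ A] [CompleteSpace A] [StarModule ℝ A]
    (hA : ∀ a : A, IsUnit (1 + star a * a)) (V : A →L[ℝ] A →L[ℝ] ℝ)
    (hsym : ∀ x y : A, V x y = V y x)
    (hV : ∀ a c : A, a * c = 0 → c * a = 0 → V a c = 0)
    {a : A} (ha : IsSelfAdjoint a) : V a a = V (a * a) 1 := by
  obtain ⟨Φ, hΦ, f, hf⟩ := ha.exists_continuousMap_algHom hA
  have h := ContinuousMap.apply_self_eq_of_orthogonal
    (LinearMap.mk₂ ℝ (fun g₁ g₂ => V (Φ g₁) (Φ g₂)) (by simp) (by simp) (by simp) (by simp))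
    (norm_nonneg V)
    (fun g₁ g₂ => (V.le_opNorm₂ _ _).trans (by gcongr <;> exact hΦ _))
    (fun g₁ g₂ => hsym _ _)
    (fun g₁ g₂ hg => hV _ _ (by rw [← map_mul, hg, map_zero])
      (by rw [← map_mul, mul_comm, hg, map_zero])) f
  simpa [hf, hsym 1] using h

/-- Let `A` be a unital real C*-algebra and `V` a bounded, symmetric,
real-bilinear orthogonal form on `A`.  With `φ₁ x := V x 1`, one has
`V a b = φ₁ ((a b + b a)/2)` for all self-adjoint `a, b ∈ A`. -/
theorem stmt_1 {A : Type*} [NormedRing A] [StarRing A] [CStarRing A] [NormedAlgebra ℝ A]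
    [CompleteSpace A] [StarModule ℝ A]
    (hA : ∀ a : A, IsUnit (1 + star a * a))
    (V : A →L[ℝ] A →L[ℝ] ℝ)
    (hsym : ∀ x y : A, V x y = V y x)
    (hV : ∀ a b : A, a * star b = 0 → star b * a = 0 → V a (star b) = 0)
    (φ₁ : A → ℝ) (hφ₁ : ∀ x : A, φ₁ x = V x 1) :
    ∀ a b : A, star a = a → star b = b → V a b = φ₁ ((2 : ℝ)⁻¹ • (a * b + b * a)) := by
  intro a b ha hb
  have hV' (x y : A) (h₁ : x * y = 0) (h₂ : y * x = 0) : V x y = 0 := by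
    simpa using hV x (star y) (by simpa using h₁) (by simpa using h₂)
  have hsq {x : A} (hx : IsSelfAdjoint x) := hx.apply_self_of_orthogonal hA V hsym hV'
  have hab := hsq (IsSelfAdjoint.add ha hb)
  simp only [map_add, add_mul, mul_add, add_apply, hsq ha, hsq hb,
    hsym b a] at hab
  rw [hφ₁, map_smul, map_add, smul_apply, add_apply,
    smul_eq_mul]
  linarith
end

section
/- Let A and B be unital commutative real C*-algebras and let T : A → B be a real-linear bijection (not assumed bounded) which is orthogonality preserving, i.e., a ⊥ b in A implies T(a) ⊥ T(b) in B. Then T is continuous. -/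
namespace AutomaticContinuity

open Filter Topology Set

/-- A bump function at a point of an open subset of a compact Hausdorff space. -/
theorem exists_bump {K : Type*} [TopologicalSpace K] [CompactSpace K] [T2Space K]
    {V : Set K} (hV : IsOpen V) {k : K} (hk : k ∈ V) :
    ∃ h : C(K, ℝ), tsupport h ⊆ V ∧ (∀ᶠ j in 𝓝 k, h j = 1) ∧ ∀ j, h j ∈ Icc (0 : ℝ) 1 := by
  obtain ⟨t, ht, htc, htV⟩ := exists_mem_nhds_isClosed_subset (hV.mem_nhds hk)
  obtain ⟨h, h1, h2, h3⟩ :=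
    exists_tsupport_one_of_isOpen_isClosed hV isClosed_closure.isCompact htc htV
  exact ⟨h, h1, Filter.mem_of_superset ht h2, h3⟩

/-- A `C(K, ℝ)`-module structure on a normed space `E`, together with a pointwise modulus
computing the norm. -/
structure FunctionModule (K E : Type*) [TopologicalSpace K] [NormedAddCommGroup E]
    [NormedSpace ℝ E] where
  /-- The action of continuous functions. -/
  act : C(K, ℝ) →ₐ[ℝ] Module.End ℝ E
  /-- The modulus of an element at a point. -/
  modulus : K → Seminorm ℝ E
  continuous_modulus : ∀ f, Continuous fun k ↦ modulus k f
  modulus_act : ∀ k h f, modulus k (act h f) = |h k| * modulus k f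
  modulus_le_norm : ∀ k f, modulus k f ≤ ‖f‖
  norm_le : ∀ f C, 0 ≤ C → (∀ k, modulus k f ≤ C) → ‖f‖ ≤ C

namespace FunctionModule

variable {K E : Type*} [TopologicalSpace K] [NormedAddCommGroup E] [NormedSpace ℝ E]

/-- Two elements are disjoint if their moduli have disjoint supports. -/
def Disj (M : FunctionModule K E) (f g : E) : Prop :=
  ∀ k, M.modulus k f = 0 ∨ M.modulus k g = 0

/-- `k` is a support point of `p` if `p` kills every element vanishing near `k`. -/
def IsSupport (M : FunctionModule K E) (p : Seminorm ℝ E) (k : K) : Prop :=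
  ∀ f, (∀ᶠ j in 𝓝 k, M.modulus j f = 0) → p f = 0

theorem act_sub (M : FunctionModule K E) (h : C(K, ℝ)) (f : E) :
    f - M.act h f = M.act (1 - h) f := by
  simp

theorem eventually_modulus_act_eq_zero (M : FunctionModule K E) {h : C(K, ℝ)} (f : E) {k : K}
    (hk : k ∉ tsupport h) : ∀ᶠ j in 𝓝 k, M.modulus j (M.act h f) = 0 := by
  filter_upwards [(isClosed_tsupport h).isOpen_compl.mem_nhds hk] with j hj
  rw [M.modulus_act, image_eq_zero_of_notMem_tsupport hj, abs_zero, zero_mul]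

theorem seminorm_eq_of_sub {p : Seminorm ℝ E} {f g : E} (h : p (f - g) = 0) : p f = p g := by
  have := abs_sub_map_le_sub p f g
  rw [h] at this
  exact sub_eq_zero.1 (abs_nonpos_iff.1 this)

/-- Multiplying by a function equal to one near a support point does not change the value. -/
theorem IsSupport.act_eq {M : FunctionModule K E} {p : Seminorm ℝ E} {k : K}
    (hp : M.IsSupport p k) {h : C(K, ℝ)} (hh : ∀ᶠ j in 𝓝 k, h j = 1) (f : E) :
    p (M.act h f) = p f := by
  refine (seminorm_eq_of_sub (hp _ ?_)).symm
  filter_upwards [hh] with j hj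
  rw [act_sub, M.modulus_act]
  simp [hj]

theorem seminorm_sum_eq_zero {ι : Type*} (p : Seminorm ℝ E) {s : Finset ι} {x : ι → E}
    (h : ∀ i ∈ s, p (x i) = 0) : p (∑ i ∈ s, x i) = 0 :=
  le_antisymm ((Finset.le_sum_of_subadditive p (map_zero p).le (map_add_le_add p) s x).trans
    (Finset.sum_nonpos fun i hi ↦ (h i hi).le)) (apply_nonneg _ _)

/-- The bounded evaluations are uniformly bounded. -/
theorem exists_uniform_bound [CompleteSpace E] {L F : Type*} [TopologicalSpace L]
    [NormedAddCommGroup F] [NormedSpace ℝ F] (N : FunctionModule L F)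
    (T : E →ₗ[ℝ] F) :
    ∃ C, 0 ≤ C ∧ ∀ y, (∃ D, ∀ f, N.modulus y (T f) ≤ D * ‖f‖) →
      ∀ f, N.modulus y (T f) ≤ C * ‖f‖ := by
  let p : {y // ∃ D, ∀ f, N.modulus y (T f) ≤ D * ‖f‖} → Seminorm ℝ E :=
    fun y ↦ (N.modulus y).comp T
  have hbdd : BddAbove (range p) := by
    rw [Seminorm.bddAbove_range_iff]
    rintro f
    refine ⟨‖T f‖, ?_⟩
    rintro _ ⟨y, rfl⟩
    exact N.modulus_le_norm _ _
  have hcont : ∀ y, Continuous (p y) := by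
    rintro ⟨y, D, hD⟩
    refine Seminorm.continuous_of_continuousAt_zero ?_
    rw [ContinuousAt, map_zero]
    refine squeeze_zero (fun f ↦ apply_nonneg _ f) hD ?_
    have : Continuous fun f : E ↦ D * ‖f‖ := by fun_prop
    simpa using this.tendsto 0
  have h := Seminorm.continuous_iSup p hcont hbdd
  rw [← Seminorm.coe_iSup_eq hbdd] at h
  obtain ⟨C, hC, hle⟩ := Seminorm.bound_of_continuous_normedSpace _ h
  refine ⟨C, hC.le, fun y hy f ↦ le_trans ?_ (hle f)⟩
  exact (le_ciSup hbdd ⟨y, hy⟩ : p ⟨y, hy⟩ ≤ _) f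

variable [CompactSpace K] [T2Space K]

theorem exists_isSupport (M : FunctionModule K E) (p : Seminorm ℝ E)
    (hp : ∀ f g, M.Disj f g → p f = 0 ∨ p g = 0) {e : E} (he : p e ≠ 0) :
    ∃ k, M.IsSupport p k := by
  by_contra! H
  simp only [IsSupport, not_forall] at H
  choose g hg hpg using H
  choose U hU hUo hkU using fun k ↦ eventually_nhds_iff.1 (hg k)
  obtain ⟨ρ, hρ⟩ := PartitionOfUnity.exists_isSubordinate isClosed_univ U hUo
    (fun k _ ↦ mem_iUnion.2 ⟨k, hkU k⟩)
  obtain ⟨t, ht⟩ := isCompact_univ.elim_finite_subcover U hUo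
    (fun k _ ↦ mem_iUnion.2 ⟨k, hkU k⟩)
  have hz : ∀ (h : C(K, ℝ)) (k : K), tsupport h ⊆ U k → ∀ f, p (M.act h f) = 0 := by
    intro h k hs f
    refine (hp (M.act h f) (g k) fun j ↦ ?_).resolve_right (hpg k)
    by_cases hj : j ∈ U k
    · exact Or.inr (hU k j hj)
    · left
      rw [M.modulus_act, image_eq_zero_of_notMem_tsupport (fun h' ↦ hj (hs h')), abs_zero, zero_mul]
  have hfin : {i | (Function.support (ρ i)).Nonempty}.Finite := by
    simpa using ρ.locallyFinite.finite_nonempty_of_compact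
  have hsum : ∑ i ∈ hfin.toFinset, (ρ i : C(K, ℝ)) = 1 := by
    ext j
    have := ρ.sum_eq_one (mem_univ j)
    rw [finsum_eq_sum_of_support_subset (s := hfin.toFinset)] at this
    · simpa using this
    · intro i hi
      simp only [Finite.coe_toFinset, mem_ofPred_eq]
      exact ⟨j, hi⟩
  apply he
  have : e = ∑ i ∈ hfin.toFinset, M.act (ρ i) e := by
    rw [← LinearMap.sum_apply, ← map_sum, hsum, map_one, Module.End.one_apply]
  rw [this]
  exact seminorm_sum_eq_zero p fun i _ ↦ hz (ρ i) i (hρ i) e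

/-- A bounded seminorm supported at `k` only depends on the values at `k`. -/
theorem IsSupport.eq_zero_of_modulus_eq_zero {M : FunctionModule K E} {p : Seminorm ℝ E} {k : K}
    (hp : M.IsSupport p k) {C : ℝ} (hC : ∀ f, p f ≤ C * ‖f‖) {f : E}
    (hf : M.modulus k f = 0) : p f = 0 := by
  refine le_antisymm (le_of_forall_pos_le_add fun ε hε ↦ ?_) (apply_nonneg _ _)
  set δ := ε / (|C| + 1)
  have hδ : 0 < δ := by positivity
  have hV : IsOpen {j | M.modulus j f < δ} := isOpen_lt (M.continuous_modulus f) continuous_const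
  obtain ⟨h, hs, h1, h01⟩ := exists_bump hV (k := k) (by simpa [hf] using hδ)
  rw [← hp.act_eq h1, zero_add]
  have hn : ‖M.act h f‖ ≤ δ := by
    refine M.norm_le _ _ hδ.le fun j ↦ ?_
    rw [M.modulus_act]
    by_cases hj : j ∈ tsupport h
    · rw [abs_of_nonneg (h01 j).1]
      have : M.modulus j f ≤ δ := (hs hj).le
      nlinarith [(h01 j).1, (h01 j).2, apply_nonneg (M.modulus j) f]
    · simp [image_eq_zero_of_notMem_tsupport hj, hδ.le]
  calc p (M.act h f) ≤ C * ‖M.act h f‖ := hC _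
    _ ≤ |C| * ‖M.act h f‖ := by gcongr; exact le_abs_self C
    _ ≤ (|C| + 1) * δ := by gcongr; linarith
    _ = ε := by simp only [δ]; field_simp

/-- A seminorm which kills the kernel of a finite-rank continuous map and comes from a linear map
is bounded. -/
theorem exists_bound_of_ker_le {F W : Type*} [NormedAddCommGroup F] [NormedSpace ℝ F]
    [NormedAddCommGroup W] [NormedSpace ℝ W] [FiniteDimensional ℝ W]
    (T : E →ₗ[ℝ] F) (q : Seminorm ℝ F) (hq : ∀ g, q g ≤ ‖g‖) (R : E →L[ℝ] W)
    (hR : ∀ f, R f = 0 → q (T f) = 0) : ∃ C, ∀ f, q (T f) ≤ C * ‖f‖ := by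
  obtain ⟨S, hS⟩ := (R : E →ₗ[ℝ] W).rangeRestrict.exists_rightInverse_of_surjective
    (LinearMap.range_rangeRestrict _)
  let TS := LinearMap.toContinuousLinearMap (T ∘ₗ S)
  refine ⟨‖TS‖ * ‖R‖, fun f ↦ ?_⟩
  set w := (R : E →ₗ[ℝ] W).rangeRestrict f
  have hw : R (f - S w) = 0 := by
    have : (R : E →ₗ[ℝ] W).rangeRestrict (S w) = w := LinearMap.congr_fun hS w
    have := congrArg Subtype.val this
    rw [map_sub, sub_eq_zero]
    exact this.symm
  have h1 : q (T f) = q (TS w) := by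
    refine seminorm_eq_of_sub ?_
    have := hR _ hw
    rwa [map_sub] at this
  calc q (T f) ≤ ‖TS w‖ := h1 ▸ hq _
    _ ≤ ‖TS‖ * ‖w‖ := TS.le_opNorm _
    _ ≤ ‖TS‖ * (‖R‖ * ‖f‖) := by gcongr; exact R.le_opNorm f
    _ = _ := by ring

/-- Gliding hump: in a pointwise bounded sequence of seminorms supported at points of disjoint open
sets, some member is bounded. -/
theorem exists_bound_of_pairwise_disjoint [CompleteSpace E] (M : FunctionModule K E)
    (p : ℕ → Seminorm ℝ E) (k : ℕ → K) (V : ℕ → Set K) (hV : ∀ n, IsOpen (V n))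
    (hd : Pairwise (Function.onFun Disjoint V)) (hk : ∀ n, k n ∈ V n)
    (hp : ∀ n, M.IsSupport (p n) (k n)) (hb : ∀ f, ∃ D, ∀ n, p n f ≤ D) :
    ∃ n C, ∀ f, p n f ≤ C * ‖f‖ := by
  by_contra! H
  have hg : ∀ n : ℕ, ∃ g : E, ‖g‖ ≤ (1 / 2) ^ n ∧ (n : ℝ) ≤ p n g := by
    intro n
    obtain ⟨f, hf⟩ := H n (n * 2 ^ n)
    have hf0 : 0 < ‖f‖ := by
      rw [norm_pos_iff]
      rintro rfl
      simp at hf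
    have h2 : (0 : ℝ) < 2 ^ n := by positivity
    refine ⟨(2 ^ n * ‖f‖)⁻¹ • f, ?_, ?_⟩
    · rw [norm_smul, norm_inv, Real.norm_of_nonneg (by positivity)]
      field_simp
      simp
    · rw [map_smul_eq_mul, norm_inv, Real.norm_of_nonneg (by positivity),
        le_inv_mul_iff₀ (by positivity)]
      linarith
  choose g hgn hgp using hg
  choose h hs h1 h01 using fun n ↦ exists_bump (hV n) (hk n)
  have hm : ∀ n j, M.modulus j (M.act (h n) (g n)) ≤ (1 / 2) ^ n := by
    intro n j
    rw [M.modulus_act, abs_of_nonneg (h01 n j).1]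
    have := (M.modulus_le_norm j (g n)).trans (hgn n)
    nlinarith [(h01 n j).1, (h01 n j).2, apply_nonneg (M.modulus j) (g n)]
  have hsum : Summable fun n ↦ M.act (h n) (g n) :=
    Summable.of_norm_bounded summable_geometric_two
      fun n ↦ M.norm_le _ _ (by positivity) (hm n)
  set f := ∑' n, M.act (h n) (g n)
  have hcont : ∀ j, Continuous (M.modulus j) := fun j ↦
    Seminorm.continuous_of_le (q := normSeminorm ℝ E) continuous_norm
      fun x ↦ M.modulus_le_norm j x
  have hf : ∀ n, p n f = p n (g n) := by
    intro n
    rw [← (hp n).act_eq (h1 n) (g n)]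
    refine seminorm_eq_of_sub (hp n _ ?_)
    filter_upwards [(hV n).mem_nhds (hk n)] with j hj
    have ht : Tendsto (fun s : Finset ℕ ↦
        M.modulus j (∑ i ∈ s, M.act (h i) (g i) - M.act (h n) (g n))) atTop
        (𝓝 (M.modulus j (f - M.act (h n) (g n)))) :=
      ((hcont j).tendsto _).comp (hsum.hasSum.sub_const _)
    refine tendsto_nhds_unique ht (tendsto_const_nhds.congr' ?_)
    filter_upwards [eventually_ge_atTop {n}] with s hns
    rw [← Finset.sum_erase_eq_sub (Finset.singleton_subset_iff.1 hns)]
    refine (seminorm_sum_eq_zero _ fun i hi ↦ ?_).symm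
    have : j ∉ tsupport (h i) := fun hj' ↦
      disjoint_left.1 (hd (Finset.ne_of_mem_erase hi)) (hs i hj') hj
    rw [M.modulus_act, image_eq_zero_of_notMem_tsupport this, abs_zero, zero_mul]
  obtain ⟨D, hD⟩ := hb f
  obtain ⟨n, hn⟩ := exists_nat_gt D
  have := hD n
  rw [hf n] at this
  linarith [hgp n]

section Main

variable {L F : Type*} [TopologicalSpace L]
  [NormedAddCommGroup F] [NormedSpace ℝ F] [CompleteSpace E]

/-- Unbounded evaluations have support points only in a nowhere dense set. -/
theorem exists_open_subset_forall_bound (M : FunctionModule K E) (N : FunctionModule L F)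
    (hfib : ∀ k, ∃ R : E →L[ℝ] ℝ × ℝ, ∀ f, R f = 0 → M.modulus k f = 0)
    (T : E →ₗ[ℝ] F) {U : Set K} (hU : IsOpen U) (hne : U.Nonempty) :
    ∃ V ⊆ U, IsOpen V ∧ V.Nonempty ∧ ∀ y, ∀ k ∈ V, M.IsSupport ((N.modulus y).comp T) k →
      ∃ C, ∀ f, N.modulus y (T f) ≤ C * ‖f‖ := by
  by_cases hfin : Finite U
  · obtain ⟨k, hk⟩ := hne
    have hkU : IsOpen {k} := by
      have := hU.isOpenMap_subtype_val {(⟨k, hk⟩ : U)} (isOpen_discrete _)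
      simpa using this
    refine ⟨{k}, by simpa using hk, hkU, singleton_nonempty k, ?_⟩
    intro y k' hk' hs
    rw [mem_singleton_iff.1 hk'] at hs
    obtain ⟨R, hR⟩ := hfib k
    refine exists_bound_of_ker_le T (N.modulus y) (N.modulus_le_norm y) R fun f hf ↦ hs f ?_
    rw [(isOpen_singleton_iff_nhds_eq_pure k).1 hkU]
    exact hR f hf
  · have : Infinite U := not_finite_iff_infinite.1 hfin
    by_contra! H
    obtain ⟨V, hVi, hVo, hVd⟩ := exists_seq_infinite_isOpen_pairwise_disjoint U
    have H' := fun n ↦ H (Subtype.val '' V n) (Subtype.coe_image_subset _ _)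
      (hU.isOpenMap_subtype_val _ (hVo n)) ((hVi n).nonempty.image _)
    choose y k hk hs hu using H'
    obtain ⟨n, C, hC⟩ := M.exists_bound_of_pairwise_disjoint
      (fun n ↦ (N.modulus (y n)).comp T) k _
      (fun n ↦ hU.isOpenMap_subtype_val _ (hVo n))
      (fun i j hij ↦ (disjoint_image_iff Subtype.val_injective).2 (hVd hij)) hk hs
      (fun f ↦ ⟨‖T f‖, fun n ↦ N.modulus_le_norm _ _⟩)
    obtain ⟨f, hf⟩ := hu n C
    exact hf.not_ge (hC f)

/-- A disjointness preserving linear bijection between function modules with finite-dimensional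
fibres on the domain is continuous. -/
theorem continuous_of_bijective [CompactSpace L] [T2Space L] (M : FunctionModule K E)
    (N : FunctionModule L F)
    (hfib : ∀ k, ∃ R : E →L[ℝ] ℝ × ℝ, ∀ f, R f = 0 → M.modulus k f = 0)
    (T : E →ₗ[ℝ] F) (hbij : Function.Bijective T)
    (hT : ∀ f g, M.Disj f g → N.Disj (T f) (T g)) : Continuous T := by
  obtain ⟨C, hC0, hC⟩ := N.exists_uniform_bound T
  have hsupp : ∀ y f, N.modulus y (T f) ≠ 0 → ∃ k, M.IsSupport ((N.modulus y).comp T) k :=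
    fun y f hf ↦ M.exists_isSupport ((N.modulus y).comp T) (fun f g hfg ↦ hT f g hfg y) hf
  have hclosed : IsClosed {y | ∀ f, N.modulus y (T f) ≤ C * ‖f‖} := by
    simp only [ofPred_forall]
    exact isClosed_iInter fun f ↦ isClosed_le (N.continuous_modulus _) continuous_const
  suffices H : ∀ y f, N.modulus y (T f) ≤ C * ‖f‖ from
    AddMonoidHomClass.continuous_of_bound T C fun f ↦
      N.norm_le _ _ (by positivity) fun y ↦ H y f
  by_contra! H
  obtain ⟨y₀, e, he⟩ := H
  obtain ⟨h, hs, h1, -⟩ := exists_bump hclosed.isOpen_compl (k := y₀) (fun h' ↦ (h' e).not_gt he)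
  obtain ⟨f, hf⟩ := hbij.2 (N.act h (T e))
  have hTf : ∀ y, (∀ g, N.modulus y (T g) ≤ C * ‖g‖) → N.modulus y (T f) = 0 := by
    intro y hy
    rw [hf, N.modulus_act, image_eq_zero_of_notMem_tsupport fun h' ↦ hs h' hy, abs_zero, zero_mul]
  have hf0 : ∃ k, M.modulus k f ≠ 0 := by
    by_contra! hk
    have : f = 0 := norm_le_zero_iff.1 (M.norm_le _ _ le_rfl fun k ↦ (hk k).le)
    have h' : N.modulus y₀ (T f) = N.modulus y₀ (T e) := by
      rw [hf, N.modulus_act, h1.self_of_nhds, abs_one, one_mul]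
    rw [this, map_zero, map_zero] at h'
    have : 0 ≤ C * ‖e‖ := by positivity
    linarith
  obtain ⟨V, hVU, hVo, ⟨v, hv⟩, hV⟩ := M.exists_open_subset_forall_bound N hfib T
    (U := {k | M.modulus k f ≠ 0}) (isOpen_ne_fun (M.continuous_modulus f) continuous_const) hf0
  obtain ⟨b, hbs, hb1, -⟩ := exists_bump hVo hv
  have hbf : M.act b f ≠ 0 := by
    intro h0
    have := M.modulus_act v b f
    rw [h0, map_zero, hb1.self_of_nhds, abs_one, one_mul] at this
    exact hVU hv this.symm
  apply hbf
  apply hbij.1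
  rw [map_zero]
  refine norm_le_zero_iff.1 (N.norm_le _ _ le_rfl fun y ↦ ?_)
  by_contra! hy
  obtain ⟨k, hk⟩ := hsupp y _ hy.ne'
  have hkV : k ∈ V := by
    by_contra hkV
    exact hy.ne' (hk _ (M.eventually_modulus_act_eq_zero f fun h' ↦ hkV (hbs h')))
  have hyC := hC y (hV y k hkV hk)
  have hz : (N.modulus y).comp T (M.act b f - b k • f) = 0 := by
    refine hk.eq_zero_of_modulus_eq_zero hyC ?_
    have : M.act b f - b k • f = M.act (b - algebraMap ℝ _ (b k)) f := by
      rw [map_sub, AlgHom.commutes]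
      simp
    rw [this, M.modulus_act]
    simp
  have := seminorm_eq_of_sub hz
  rw [map_smul_eq_mul, Seminorm.comp_apply, Seminorm.comp_apply, hTf y hyC, mul_zero] at this
  exact hy.ne' this

end Main

end FunctionModule

section DualMul

variable {R : Type*} [NormedCommRing R] [NormedAlgebra ℝ R]

theorem norm_comp_mul_le (a : R) (φ : R →L[ℝ] ℂ) :
    ‖φ.comp (ContinuousLinearMap.mul ℝ R a)‖ ≤ ‖a‖ * ‖φ‖ := by
  rw [mul_comm]
  refine (ContinuousLinearMap.opNorm_comp_le φ _).trans ?_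
  gcongr
  exact ContinuousLinearMap.opNorm_mul_apply_le ℝ R a

/-- The multiplication operator on the complex-valued dual of a real normed algebra. -/
noncomputable def dualMulOperator (a : R) : (R →L[ℝ] ℂ) →L[ℂ] (R →L[ℝ] ℂ) :=
  LinearMap.mkContinuous
    { toFun := fun φ ↦ φ.comp (ContinuousLinearMap.mul ℝ R a)
      map_add' := fun _ _ ↦ rfl
      map_smul' := fun _ _ ↦ rfl } ‖a‖ (norm_comp_mul_le a)

theorem dualMulOperator_apply (a : R) (φ : R →L[ℝ] ℂ) (x : R) :
    dualMulOperator a φ x = φ (a * x) := rfl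

variable (R) in
/-- The representation of a real commutative normed algebra on its complex-valued dual. -/
noncomputable def dualMul : R →+* ((R →L[ℝ] ℂ) →L[ℂ] (R →L[ℝ] ℂ)) where
  toFun := dualMulOperator
  map_one' := by ext φ x; simp [dualMulOperator_apply]
  map_mul' a b := by
    ext φ x
    simp only [dualMulOperator_apply, mul_apply_eq_comp]
    rw [mul_comm a b, mul_assoc]
  map_zero' := by ext φ x; simp [dualMulOperator_apply]
  map_add' a b := by ext φ x; simp [dualMulOperator_apply, add_mul]

theorem dualMul_apply (a : R) (φ : R →L[ℝ] ℂ) (x : R) : dualMul R a φ x = φ (a * x) := rfl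

theorem dualMul_algebraMap (r : ℝ) : dualMul R (algebraMap ℝ R r) =
    (r : ℂ) • (1 : (R →L[ℝ] ℂ) →L[ℂ] (R →L[ℝ] ℂ)) := by
  ext φ x
  change φ (algebraMap ℝ R r * x) = (r : ℂ) * φ x
  rw [← Algebra.smul_def, map_smul, Complex.real_smul]

theorem norm_dualMul (h1 : ‖(1 : R)‖ = 1) (a : R) : ‖dualMul R a‖ = ‖a‖ := by
  refine le_antisymm (LinearMap.mkContinuous_norm_le _ (norm_nonneg a) (norm_comp_mul_le a)) ?_
  by_cases ha : ‖a‖ = 0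
  · rw [ha]; exact ContinuousLinearMap.opNorm_nonneg _
  obtain ⟨g, hg1, hga⟩ := exists_dual_vector ℝ a ha
  let φ : R →L[ℝ] ℂ := Complex.ofRealCLM.comp g
  have hφ : ‖φ‖ ≤ 1 := by
    refine ContinuousLinearMap.opNorm_le_bound _ zero_le_one fun x ↦ ?_
    simpa [φ, hg1] using g.le_opNorm x
  calc ‖a‖ = ‖dualMul R a φ 1‖ := by simp [dualMul_apply, φ, hga]
    _ ≤ ‖dualMul R a φ‖ * ‖(1 : R)‖ := ContinuousLinearMap.le_opNorm _ _
    _ = ‖dualMul R a φ‖ := by rw [h1, mul_one]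
    _ ≤ ‖dualMul R a‖ * ‖φ‖ := ContinuousLinearMap.le_opNorm _ _
    _ ≤ ‖dualMul R a‖ := mul_le_of_le_one_right (ContinuousLinearMap.opNorm_nonneg _) hφ

end DualMul

open WeakDual in
/-- In a complex commutative Banach algebra, an element whose norm is multiplicative on iterated
squares attains its norm at a character. -/
theorem exists_character_norm_eq {M : Type*} [NormedCommRing M] [NormedAlgebra ℂ M]
    [CompleteSpace M] [Nontrivial M] {b : M} (hb : ∀ n : ℕ, ‖b ^ 2 ^ n‖₊ = ‖b‖₊ ^ 2 ^ n) :
    ∃ χ : characterSpace ℂ M, ‖χ b‖ = ‖b‖ := by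
  have hr : spectralRadius ℂ b = ‖b‖₊ := by
    refine tendsto_nhds_unique ?_ (tendsto_const_nhds (x := (‖b‖₊ : ENNReal)) (f := atTop (α := ℕ)))
    convert! (spectrum.pow_nnnorm_pow_one_div_tendsto_nhds_spectralRadius b).comp
      (tendsto_pow_atTop_atTop_of_one_lt one_lt_two) using 1
    refine funext fun n => ?_
    rw [Function.comp_apply, hb, ENNReal.coe_pow, ← ENNReal.rpow_natCast, ← ENNReal.rpow_mul]
    simp
  obtain ⟨z, hz, hzr⟩ := spectrum.exists_nnnorm_eq_spectralRadius b
  obtain ⟨χ, rfl⟩ := CharacterSpace.mem_spectrum_iff_exists.1 hz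
  refine ⟨χ, ?_⟩
  rw [hr] at hzr
  exact congrArg NNReal.toReal (ENNReal.coe_injective hzr)

theorem norm_one_of_norm_mul_self {R : Type*} [NormedCommRing R] [Nontrivial R]
    (hsq : ∀ a : R, ‖a * a‖ = ‖a‖ * ‖a‖) :
    ‖(1 : R)‖ = 1 := by
  have := hsq 1
  rw [mul_one] at this
  exact (mul_eq_left₀ (norm_ne_zero_iff.2 one_ne_zero)).1 this.symm

section RealFunctionAlgebra

open WeakDual

variable {R : Type*} [NormedCommRing R] [NormedAlgebra ℝ R]

/-- A real commutative Banach algebra embedded isometrically in a complex Banach algebra has, for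
each element satisfying `‖a ^ 2 ^ n‖ = ‖a‖ ^ 2 ^ n`, a complex character attaining its norm. -/
theorem exists_complex_character_norm_eq {D : Type*} [NormedRing D] [NormedAlgebra ℂ D]
    [CompleteSpace D] [Nontrivial R] (ι : R →+* D) (hι : ∀ x, ‖ι x‖ = ‖x‖)
    (hιr : ∀ r : ℝ, ι (algebraMap ℝ R r) = algebraMap ℂ D r) {a : R}
    (hpow : ∀ n : ℕ, ‖a ^ 2 ^ n‖ = ‖a‖ ^ 2 ^ n) :
    ∃ ψ : R →ₐ[ℝ] ℂ, ‖ψ a‖ = ‖a‖ := by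
  let S := (Algebra.adjoin ℂ (range ι)).topologicalClosure
  have hcomm : ∀ x y : S, x * y = y * x := by
    have h0 : IsMulCommutative (Algebra.adjoin ℂ (range ι)) := by
      refine Algebra.isMulCommutative_adjoin ℂ ?_
      rintro _ ⟨x, rfl⟩ _ ⟨y, rfl⟩
      rw [← map_mul, ← map_mul, mul_comm]
    exact (Subalgebra.commRingTopologicalClosure _ fun x y ↦ h0.is_comm.comm x y).mul_comm
  let : NormedCommRing S := { (inferInstance : NormedRing S) with mul_comm := hcomm }
  have : CompleteSpace S :=
    (Subalgebra.isClosed_topologicalClosure _).completeSpace_coe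
  let j : R →+* S := ι.codRestrict S fun x ↦
    Subalgebra.le_topologicalClosure _ (Algebra.subset_adjoin ⟨x, rfl⟩)
  have hj : ∀ x, ‖j x‖ = ‖x‖ := hι
  have : Nontrivial S := ⟨j 1, 0, fun h ↦ by
    have := hj 1
    rw [h, norm_zero] at this
    exact one_ne_zero (norm_eq_zero.1 this.symm)⟩
  obtain ⟨χ, hχ⟩ := exists_character_norm_eq (b := j a) fun n ↦ by
    apply NNReal.coe_injective
    push_cast
    rw [← map_pow, hj, hj, hpow]
  have hjr : ∀ r : ℝ, χ (j (algebraMap ℝ R r)) = r := by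
    intro r
    have : j (algebraMap ℝ R r) = algebraMap ℂ S (r : ℂ) := Subtype.ext (hιr r)
    rw [this, AlgHomClass.commutes]
    rfl
  let ψ : R →ₐ[ℝ] ℂ :=
    { ((CharacterSpace.toAlgHom χ : S →ₐ[ℂ] ℂ) : S →+* ℂ).comp j with
      commutes' := hjr }
  exact ⟨ψ, hχ.trans (hj a)⟩

variable [CompleteSpace R]

/-- In a real commutative Banach algebra with `‖a ^ 2‖ = ‖a‖ ^ 2` in which every `1 + a ^ 2` is
invertible, every element attains its norm at a real character. -/
theorem exists_real_character_abs_eq [Nontrivial R] (hsq : ∀ a : R, ‖a * a‖ = ‖a‖ * ‖a‖)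
    (hinv : ∀ a : R, IsUnit (1 + a * a)) (a : R) :
    ∃ φ : characterSpace ℝ R, |φ a| = ‖a‖ := by
  have h1 := norm_one_of_norm_mul_self hsq
  have hpow : ∀ n : ℕ, ‖a ^ 2 ^ n‖ = ‖a‖ ^ 2 ^ n := by
    intro n
    induction n with
    | zero => simp
    | succ n ih => rw [pow_succ 2, pow_mul, pow_two, hsq, ih, pow_mul, pow_two]
  obtain ⟨ψ, hψ⟩ := exists_complex_character_norm_eq
    (D := (R →L[ℝ] ℂ) →L[ℂ] (R →L[ℝ] ℂ)) (dualMul R) (norm_dualMul h1)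
    (fun r ↦ by rw [dualMul_algebraMap, Algebra.algebraMap_eq_smul_one]) hpow
  have him : ∀ x, (ψ x).im = 0 := by
    intro x
    by_contra hx
    set w := (ψ x).im⁻¹ • (x - algebraMap ℝ R (ψ x).re)
    have hw : ψ w = Complex.I := by
      simp only [w, map_smul, map_sub, AlgHom.commutes]
      apply Complex.ext <;> simp [hx]
    have := (hinv w).map ψ
    simp [hw] at this
  have hre : ∀ x, ψ x = ((ψ x).re : ℂ) := fun x ↦ Complex.ext rfl (by simp [him x])
  let φ : R →ₐ[ℝ] ℝ := AlgHom.ofLinearMap (Complex.reLm ∘ₗ ψ.toLinearMap) (by simp) (by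
    intro x y
    simp [him])
  refine ⟨CharacterSpace.equivAlgHom.symm φ, ?_⟩
  have : |φ a| = ‖ψ a‖ := by
    rw [hre a, Complex.norm_real]
    rfl
  rw [hψ] at this
  exact this

/-- The real Gelfand representation. -/
theorem norm_gelfandTransform_real (hsq : ∀ a : R, ‖a * a‖ = ‖a‖ * ‖a‖)
    (hinv : ∀ a : R, IsUnit (1 + a * a)) (a : R) : ‖gelfandTransform ℝ R a‖ = ‖a‖ := by
  rcases subsingleton_or_nontrivial R with h | h
  · rw [Subsingleton.elim a 0, map_zero, norm_zero, norm_zero]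
  refine le_antisymm ((ContinuousMap.norm_le _ (norm_nonneg a)).2 fun φ ↦ ?_) ?_
  · have := AlgHom.norm_apply_le_self_mul_norm_one φ a
    rwa [norm_one_of_norm_mul_self hsq, mul_one] at this
  · obtain ⟨φ, hφ⟩ := exists_real_character_abs_eq hsq hinv a
    rw [← hφ]
    exact (gelfandTransform ℝ R a).norm_coe_le_norm φ

theorem bijective_gelfandTransform_real (hsq : ∀ a : R, ‖a * a‖ = ‖a‖ * ‖a‖)
    (hinv : ∀ a : R, IsUnit (1 + a * a)) : Function.Bijective (gelfandTransform ℝ R) := by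
  have hiso : Isometry (gelfandTransform ℝ R) :=
    AddMonoidHomClass.isometry_of_norm _ (norm_gelfandTransform_real hsq hinv)
  refine ⟨hiso.injective, ?_⟩
  have hsep : (gelfandTransform ℝ R).range.SeparatesPoints := by
    intro φ ψ hne
    obtain ⟨a, ha⟩ := DFunLike.ne_iff.1 hne
    exact ⟨_, ⟨_, ⟨a, rfl⟩, rfl⟩, ha⟩
  have htop := ContinuousMap.subalgebra_topologicalClosure_eq_top_of_separatesPoints _ hsep
  have hcl : IsClosed (range (gelfandTransform ℝ R)) := hiso.isClosedEmbedding.isClosed_range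
  intro f
  have hf : f ∈ (gelfandTransform ℝ R).range.topologicalClosure := htop ▸ Algebra.mem_top
  have : f ∈ closure (range (gelfandTransform ℝ R)) := by
    simpa [← SetLike.mem_coe, Subalgebra.topologicalClosure_coe] using hf
  rwa [hcl.closure_eq] at this

end RealFunctionAlgebra

section RealCStarAlgebra

open WeakDual

variable {A : Type*} [NormedCommRing A] [StarRing A] [NormedAlgebra ℝ A] [StarModule ℝ A]

variable (A) in
/-- The subalgebra of self-adjoint elements of a commutative real *-algebra. -/
def selfAdjointSubalgebra : Subalgebra ℝ A where
  carrier := {a | star a = a}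
  mul_mem' {a b} ha hb := by
    rw [mem_ofPred_eq] at *
    rw [star_mul, ha, hb, mul_comm]
  add_mem' {a b} ha hb := by
    rw [mem_ofPred_eq] at *
    rw [star_add, ha, hb]
  algebraMap_mem' r := by
    rw [mem_ofPred_eq, ← algebraMap_star_comm, star_trivial]

theorem mem_selfAdjointSubalgebra {a : A} : a ∈ selfAdjointSubalgebra A ↔ star a = a := Iff.rfl

/-- The self-adjoint element `a* b + b* a`. -/
def selfAdjointCross (a b : A) : selfAdjointSubalgebra A :=
  ⟨star a * b + star b * a, by
    rw [mem_selfAdjointSubalgebra]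
    simp only [star_add, star_mul, star_star]
    ring⟩

/-- The self-adjoint element `a* a`. -/
def selfAdjointSq (a : A) : selfAdjointSubalgebra A :=
  ⟨star a * a, by rw [mem_selfAdjointSubalgebra, star_mul, star_star]⟩

theorem selfAdjointSq_add (a b : A) :
    selfAdjointSq (a + b) = selfAdjointSq a + selfAdjointCross a b + selfAdjointSq b := by
  apply Subtype.ext
  simp only [selfAdjointSq, selfAdjointCross, star_add, Subalgebra.coe_add]
  ring

theorem selfAdjointSq_mul (a b : A) :
    selfAdjointSq (a * b) = selfAdjointSq a * selfAdjointSq b := by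
  apply Subtype.ext
  simp only [selfAdjointSq, star_mul, Subalgebra.coe_mul]
  ring

theorem selfAdjointSq_star (a : A) : selfAdjointSq (star a) = selfAdjointSq a := by
  apply Subtype.ext
  simp only [selfAdjointSq, star_star, mul_comm]

theorem selfAdjointSq_smul (r : ℝ) (a : A) :
    selfAdjointSq (r • a) = (r * r) • selfAdjointSq a := by
  apply Subtype.ext
  simp [selfAdjointSq, smul_smul]

theorem selfAdjointSq_coe (h : selfAdjointSubalgebra A) : selfAdjointSq (h : A) = h * h := by
  apply Subtype.ext
  have : star (h : A) = h := h.2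
  simp [selfAdjointSq, this]

theorem selfAdjointCross_smul (r : ℝ) (a b : A) :
    selfAdjointCross (r • a) b = r • selfAdjointCross a b := by
  apply Subtype.ext
  simp [selfAdjointCross]

theorem isUnit_one_add_selfAdjointSq (hA : ∀ a : A, IsUnit (1 + star a * a)) (a : A) :
    IsUnit (1 + selfAdjointSq a) := by
  obtain ⟨u, hu⟩ := hA a
  have hmul : (1 + star a * a) * (↑u⁻¹ : A) = 1 := by rw [← hu, Units.mul_inv]
  have hstar : star (↑u⁻¹ : A) = ↑u⁻¹ := by
    have h2 : (1 + star a * a) * star (↑u⁻¹ : A) = 1 := by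
      have := congrArg star hmul
      simpa only [star_mul, star_add, star_one, star_star, mul_comm] using this
    rw [← hu] at h2
    exact (Units.inv_eq_of_mul_eq_one_right h2).symm
  exact IsUnit.of_mul_eq_one (⟨_, hstar⟩ : selfAdjointSubalgebra A) (Subtype.ext hmul)

theorem isUnit_one_add_selfAdjoint_mul_self (hA : ∀ a : A, IsUnit (1 + star a * a))
    (h : selfAdjointSubalgebra A) : IsUnit (1 + h * h) := by
  rw [← selfAdjointSq_coe]
  exact isUnit_one_add_selfAdjointSq hA h

theorem character_selfAdjointSq_nonneg (hA : ∀ a : A, IsUnit (1 + star a * a))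
    (φ : characterSpace ℝ (selfAdjointSubalgebra A)) (a : A) : 0 ≤ φ (selfAdjointSq a) := by
  by_contra! hneg
  set c := -φ (selfAdjointSq a) with hc
  have hc0 : 0 < c := by linarith
  have h := (isUnit_one_add_selfAdjointSq hA ((√c)⁻¹ • a)).map φ
  rw [selfAdjointSq_smul, map_add, map_one, map_smul, ← mul_inv, Real.mul_self_sqrt hc0.le,
    show φ (selfAdjointSq a) = -c by rw [hc, neg_neg], smul_eq_mul, mul_neg,
    inv_mul_cancel₀ hc0.ne', add_neg_cancel] at h
  exact not_isUnit_zero h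

theorem character_selfAdjointCross_le (hA : ∀ a : A, IsUnit (1 + star a * a))
    (φ : characterSpace ℝ (selfAdjointSubalgebra A)) (a b : A) : φ (selfAdjointCross a b) ≤
    2 * (√(φ (selfAdjointSq a)) * √(φ (selfAdjointSq b))) := by
  have ha := character_selfAdjointSq_nonneg hA φ a
  have hb := character_selfAdjointSq_nonneg hA φ b
  have hd := discrim_le_zero (a := φ (selfAdjointSq a)) (b := φ (selfAdjointCross a b))
    (c := φ (selfAdjointSq b)) fun t ↦ by
      have := character_selfAdjointSq_nonneg hA φ (t • a + b)
      rw [selfAdjointSq_add, selfAdjointSq_smul, selfAdjointCross_smul, map_add, map_add, map_smul,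
        map_smul, smul_eq_mul, smul_eq_mul] at this
      linarith
  rw [discrim] at hd
  refine (abs_le_of_sq_le_sq' ?_ (by positivity)).2
  rw [mul_pow, mul_pow, Real.sq_sqrt ha, Real.sq_sqrt hb]
  linarith

section Character

variable (hA : ∀ a : A, IsUnit (1 + star a * a))
  (φ : characterSpace ℝ (selfAdjointSubalgebra A))

/-- The modulus of an element at a character of the self-adjoint part. -/
noncomputable def characterModulus : Seminorm ℝ A :=
  Seminorm.of (fun a ↦ √(φ (selfAdjointSq a)))
    (fun a b ↦ by
      have ha := character_selfAdjointSq_nonneg hA φ a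
      have hb := character_selfAdjointSq_nonneg hA φ b
      refine Real.sqrt_le_iff.2 ⟨by positivity, ?_⟩
      rw [selfAdjointSq_add, map_add, map_add, add_sq, Real.sq_sqrt ha, Real.sq_sqrt hb]
      linarith [character_selfAdjointCross_le hA φ a b])
    (fun r a ↦ by
      rw [selfAdjointSq_smul, map_smul, smul_eq_mul, Real.sqrt_mul (mul_self_nonneg r),
        Real.sqrt_mul_self_eq_abs, Real.norm_eq_abs])

theorem characterModulus_apply (a : A) :
    characterModulus hA φ a = √(φ (selfAdjointSq a)) := rfl

theorem characterModulus_mul (a b : A) :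
    characterModulus hA φ (a * b) = characterModulus hA φ a * characterModulus hA φ b := by
  simp only [characterModulus_apply, selfAdjointSq_mul, map_mul]
  exact Real.sqrt_mul (character_selfAdjointSq_nonneg hA φ a) _

theorem characterModulus_star (a : A) :
    characterModulus hA φ (star a) = characterModulus hA φ a := by
  simp only [characterModulus_apply, selfAdjointSq_star]

theorem characterModulus_coe (h : selfAdjointSubalgebra A) :
    characterModulus hA φ h = |φ h| := by
  rw [characterModulus_apply, selfAdjointSq_coe, map_mul, Real.sqrt_mul_self_eq_abs]

end Character

variable [CStarRing A]

theorem norm_selfAdjoint_mul_self (h : selfAdjointSubalgebra A) : ‖h * h‖ = ‖h‖ * ‖h‖ := by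
  have := CStarRing.norm_star_mul_self (x := (h : A))
  rwa [show star (h : A) = h from h.2] at this

/-- Each fibre of the function module of a real C*-algebra has dimension at most two. -/
theorem exists_characterModulus_eq_zero (hA : ∀ a : A, IsUnit (1 + star a * a))
    (φ : characterSpace ℝ (selfAdjointSubalgebra A)) :
    ∃ R : A →L[ℝ] ℝ × ℝ, ∀ a, R a = 0 → characterModulus hA φ a = 0 := by
  obtain ⟨u, hu, hmod⟩ : ∃ u : A, star u = -u ∧
      ∀ t : A, star t = -t → characterModulus hA φ (u * t) = 0 → characterModulus hA φ t = 0 := by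
    by_cases h : ∃ u : A, star u = -u ∧ characterModulus hA φ u ≠ 0
    · obtain ⟨u, hu, hne⟩ := h
      refine ⟨u, hu, fun t _ ht ↦ ?_⟩
      rw [characterModulus_mul] at ht
      exact (mul_eq_zero.1 ht).resolve_left hne
    · push Not at h
      exact ⟨0, by simp, fun t ht _ ↦ h t ht⟩
  let re : A →L[ℝ] selfAdjointSubalgebra A :=
    { toFun := fun a ↦ ⟨a + star a, by
        rw [mem_selfAdjointSubalgebra, star_add, star_star, add_comm]⟩
      map_add' := fun a b ↦ Subtype.ext (by simp only [star_add, Subalgebra.coe_add]; abel)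
      map_smul' := fun r a ↦ Subtype.ext (by simp)
      cont := by
        refine Continuous.subtype_mk ?_ _
        fun_prop }
  let φ' : selfAdjointSubalgebra A →L[ℝ] ℝ := CharacterSpace.toCLM φ
  refine ⟨(φ'.comp re).prod ((φ'.comp re).comp (ContinuousLinearMap.mul ℝ A u)), fun a ha ↦ ?_⟩
  obtain ⟨h1, h2⟩ := Prod.ext_iff.1 ha
  have h1' : characterModulus hA φ (a + star a) = 0 := by
    have := characterModulus_coe hA φ (re a)
    rwa [show φ (re a) = 0 from h1, abs_zero] at this
  have h2' : characterModulus hA φ (u * (a - star a)) = 0 := by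
    have := characterModulus_coe hA φ (re (u * a))
    rw [show φ (re (u * a)) = 0 from h2, abs_zero] at this
    rw [← this]
    congr 1
    change _ = u * a + star (u * a)
    rw [star_mul, hu]
    ring
  have h3 := hmod (a - star a) (by simp) h2'
  have h4 : characterModulus hA φ ((2 : ℝ) • a) = 0 := by
    have : (2 : ℝ) • a = (a + star a) + (a - star a) := by rw [two_smul]; abel
    rw [this]
    refine le_antisymm ((map_add_le_add _ _ _).trans ?_) (apply_nonneg _ _)
    rw [h1', h3, add_zero]
  rw [map_smul_eq_mul] at h4
  simpa using h4

variable [CompleteSpace A]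

instance : CompleteSpace (selfAdjointSubalgebra A) :=
  (isClosed_eq continuous_star continuous_id).completeSpace_coe

/-- The self-adjoint part of a commutative real C*-algebra is an algebra of continuous functions. -/
noncomputable def selfAdjointGelfand (hA : ∀ a : A, IsUnit (1 + star a * a)) :
    selfAdjointSubalgebra A ≃ₐ[ℝ] C(characterSpace ℝ (selfAdjointSubalgebra A), ℝ) :=
  AlgEquiv.ofBijective (gelfandTransform ℝ _) (bijective_gelfandTransform_real
    norm_selfAdjoint_mul_self (isUnit_one_add_selfAdjoint_mul_self hA))

theorem norm_selfAdjointGelfand_sq (hA : ∀ a : A, IsUnit (1 + star a * a)) (a : A) :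
    ‖selfAdjointGelfand hA (selfAdjointSq a)‖ = ‖a‖ * ‖a‖ :=
  (norm_gelfandTransform_real norm_selfAdjoint_mul_self
    (isUnit_one_add_selfAdjoint_mul_self hA) _).trans (CStarRing.norm_star_mul_self (x := a))

/-- A commutative real C*-algebra as a module over the real function algebra of its self-adjoint
part. -/
noncomputable def realCStarFunctionModule (hA : ∀ a : A, IsUnit (1 + star a * a)) :
    FunctionModule (characterSpace ℝ (selfAdjointSubalgebra A)) A where
  act := ((Algebra.lmul ℝ A).comp (selfAdjointSubalgebra A).val).comp
    (selfAdjointGelfand hA).symm.toAlgHom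
  modulus := characterModulus hA
  continuous_modulus a :=
    ((selfAdjointGelfand hA (selfAdjointSq a)).continuous).sqrt
  modulus_act φ h a := by
    obtain ⟨b, rfl⟩ := (selfAdjointGelfand hA).surjective h
    have : ((selfAdjointGelfand hA).symm.toAlgHom (selfAdjointGelfand hA b)) = b :=
      (selfAdjointGelfand hA).symm_apply_apply b
    rw [AlgHom.comp_apply, this, AlgHom.comp_apply]
    change characterModulus hA φ (b * a) = |φ b| * _
    rw [characterModulus_mul, characterModulus_coe]
  modulus_le_norm φ a := by
    refine Real.sqrt_le_iff.2 ⟨norm_nonneg a, ?_⟩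
    rw [sq, ← norm_selfAdjointGelfand_sq hA a]
    exact (le_abs_self _).trans
      ((selfAdjointGelfand hA (selfAdjointSq a)).norm_coe_le_norm φ)
  norm_le a C hC h := by
    refine (abs_le_of_sq_le_sq' ?_ hC).2
    rw [sq, ← norm_selfAdjointGelfand_sq hA a]
    refine (ContinuousMap.norm_le _ (sq_nonneg C)).2 fun φ ↦ ?_
    have hn := character_selfAdjointSq_nonneg hA φ a
    exact (abs_of_nonneg hn).trans_le ((Real.sqrt_le_iff.1 (h φ)).2)

theorem disj_realCStarFunctionModule_iff (hA : ∀ a : A, IsUnit (1 + star a * a)) (a b : A) :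
    (realCStarFunctionModule hA).Disj a b ↔ a * star b = 0 := by
  have key : ∀ φ, (realCStarFunctionModule hA).modulus φ (a * star b) =
      (realCStarFunctionModule hA).modulus φ a * (realCStarFunctionModule hA).modulus φ b := by
    intro φ
    change characterModulus hA φ _ = characterModulus hA φ _ * characterModulus hA φ _
    rw [characterModulus_mul, characterModulus_star]
  constructor
  · intro h
    refine norm_le_zero_iff.1 ((realCStarFunctionModule hA).norm_le _ 0 le_rfl fun φ ↦ ?_)
    rw [key, mul_eq_zero.2 (h φ)]
  · intro h φ
    rw [← mul_eq_zero, ← key, h, map_zero]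

end RealCStarAlgebra

end AutomaticContinuity

/-- Every orthogonality preserving real-linear bijection between unital
commutative real C*-algebras is automatically continuous.  (A real C*-algebra is a real
Banach *-algebra with `‖a*a‖ = ‖a‖²` in which `1 + a*a` is always invertible; `a ⊥ b` means
`a b* = b* a = 0`.) -/
theorem stmt_4 {A B : Type*}
    [NormedCommRing A] [StarRing A] [CStarRing A] [NormedAlgebra ℝ A] [CompleteSpace A]
    [StarModule ℝ A]
    [NormedCommRing B] [StarRing B] [CStarRing B] [NormedAlgebra ℝ B] [CompleteSpace B]
    [StarModule ℝ B]
    (hA : ∀ a : A, IsUnit (1 + star a * a))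
    (hB : ∀ b : B, IsUnit (1 + star b * b))
    (T : A →ₗ[ℝ] B) (hbij : Function.Bijective T)
    (hT : ∀ a b : A, a * star b = 0 → star b * a = 0 →
      T a * star (T b) = 0 ∧ star (T b) * T a = 0) :
    Continuous T := by
  refine (AutomaticContinuity.realCStarFunctionModule hA).continuous_of_bijective
    (AutomaticContinuity.realCStarFunctionModule hB)
    (AutomaticContinuity.exists_characterModulus_eq_zero hA) T hbij fun a b hab ↦ ?_
  rw [AutomaticContinuity.disj_realCStarFunctionModule_iff] at hab ⊢
  exact (hT a b hab (by rwa [mul_comm])).1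
end

section
/- Every orthogonality preserving real-linear bijection T : C_r(L₁) → C_r(L₂) (not assumed bounded) is continuous. -/
noncomputable section
set_option synthInstance.maxHeartbeats 1000000
set_option maxHeartbeats 1000000

/-- The real function algebra `C_r(L)` of continuous complex-valued functions on `L` that
take real values on the closed subset `F ⊆ L`, viewed as a real subalgebra of `C(L, ℂ)`
(with pointwise operations; the involution is pointwise conjugation and the norm is the sup
norm, both inherited from `C(L, ℂ)`). -/
def Cr (L : Type*) [TopologicalSpace L] (F : Set L) : Subalgebra ℝ C(L, ℂ) where
  carrier := {f : C(L, ℂ) | ∀ t ∈ F, (f t).im = 0}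
  mul_mem' := by
    intro f g hf hg t ht
    simp [Complex.mul_im, hf t ht, hg t ht]
  one_mem' := by intro t ht; simp
  add_mem' := by intro f g hf hg t ht; simp [hf t ht, hg t ht]
  zero_mem' := by intro t ht; simp
  algebraMap_mem' := by intro r t ht; simp

open Topology Set Filter

lemma LinearMap.exists_bound_of_finiteDimensional_submodule {V E : Type*} [NormedAddCommGroup V]
    [NormedSpace ℝ V] [NormedAddCommGroup E] [NormedSpace ℝ E] (T : V →ₗ[ℝ] E) (S : Submodule ℝ V)
    [FiniteDimensional ℝ S] : ∃ M, ∀ f ∈ S, ‖T f‖ ≤ M * ‖f‖ :=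
  let G : S →L[ℝ] E := LinearMap.toContinuousLinearMap (T.comp S.subtype)
  ⟨‖G‖, fun f hf => G.le_opNorm ⟨f, hf⟩⟩

namespace Cr

variable {L : Type*} [TopologicalSpace L] {F : Set L}

/-- A real-valued continuous function, viewed as an element of `C_r(L)`. -/
def ofReal (h : C(L, ℝ)) : Cr L F :=
  ⟨⟨fun x => (h x : ℂ), by fun_prop⟩, fun t _ => by simp⟩

@[simp]
lemma ofReal_apply (h : C(L, ℝ)) (x : L) : ((ofReal h : Cr L F) : C(L, ℂ)) x = (h x : ℂ) := rfl

lemma ext_apply {f g : Cr L F} (h : ∀ x, (f : C(L, ℂ)) x = (g : C(L, ℂ)) x) : f = g :=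
  Subtype.ext (ContinuousMap.ext h)

lemma mul_eq_zero_iff {f g : Cr L F} :
    f * g = 0 ↔ ∀ x, (f : C(L, ℂ)) x = 0 ∨ (g : C(L, ℂ)) x = 0 := by
  refine ⟨fun h x => ?_, fun h => ext_apply fun x => ?_⟩
  · have := congrArg (fun k : Cr L F => (k : C(L, ℂ)) x) h
    simpa using this
  · simpa using h x

/-- Evaluation at a point of `L`, as a continuous real-linear map. -/
def evalCLM (x : L) : Cr L F →L[ℝ] ℂ :=
  ⟨⟨⟨fun f => (f : C(L, ℂ)) x, fun _ _ => rfl⟩, fun _ _ => rfl⟩,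
    (continuous_eval_const x).comp continuous_subtype_val⟩

@[simp]
lemma evalCLM_apply (x : L) (f : Cr L F) : evalCLM x f = (f : C(L, ℂ)) x := rfl

lemma isClosed_coe : IsClosed (Cr L F : Set C(L, ℂ)) := by
  have : (Cr L F : Set C(L, ℂ)) = ⋂ t ∈ F, {f : C(L, ℂ) | (f t).im = 0} := by
    ext f
    simp only [mem_iInter]
    rfl
  rw [this]
  exact isClosed_biInter fun t _ => isClosed_eq
    (Complex.continuous_im.comp (continuous_eval_const t)) continuous_const

variable [CompactSpace L]

instance : NormedSpace ℝ (Cr L F) := NormedAlgebra.toNormedSpace (𝕜 := ℝ) (Cr L F)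

lemma norm_apply_le (f : Cr L F) (x : L) : ‖(f : C(L, ℂ)) x‖ ≤ ‖f‖ :=
  (f : C(L, ℂ)).norm_coe_le_norm x

lemma norm_le {f : Cr L F} {C : ℝ} (hC : 0 ≤ C) (h : ∀ x, ‖(f : C(L, ℂ)) x‖ ≤ C) : ‖f‖ ≤ C :=
  ((f : C(L, ℂ)).norm_le hC).2 h

instance : CompleteSpace (Cr L F) := isClosed_coe.completeSpace_coe

lemma norm_ofReal_mul_le {h : C(L, ℝ)} (hh : ∀ x, h x ∈ Icc (0 : ℝ) 1) (f : Cr L F) :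
    ‖ofReal h * f‖ ≤ ‖f‖ := by
  refine norm_le (norm_nonneg _) fun x => ?_
  have h1 : ‖(h x : ℂ)‖ ≤ 1 := by
    rw [Complex.norm_real, Real.norm_of_nonneg (hh x).1]; exact (hh x).2
  calc ‖((ofReal h * f : Cr L F) : C(L, ℂ)) x‖ = ‖(h x : ℂ)‖ * ‖(f : C(L, ℂ)) x‖ := by simp
    _ ≤ 1 * ‖f‖ := mul_le_mul h1 (norm_apply_le f x) (norm_nonneg _) zero_le_one
    _ = ‖f‖ := one_mul _

lemma exists_cutoff [T2Space L] {x : L} {U : Set L} (hU : U ∈ 𝓝 x) :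
    ∃ h : C(L, ℝ), (∀ᶠ y in 𝓝 x, h y = 1) ∧ (∀ y ∉ U, h y = 0) ∧ ∀ y, h y ∈ Icc (0 : ℝ) 1 := by
  obtain ⟨K, hK, hKc, hKU⟩ := exists_mem_nhds_isClosed_subset (interior_mem_nhds.2 hU)
  obtain ⟨h, h0, h1, h01⟩ := exists_continuous_zero_one_of_isClosed
    (isOpen_interior (s := U)).isClosed_compl hKc
    (disjoint_left.2 fun y hy hyK => hy (hKU hyK))
  exact ⟨h, mem_of_superset hK h1, fun y hy => h0 fun h' => hy (interior_subset h'), h01⟩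

/-- A linear map on `C_r(L)` is bounded on the functions supported in the singleton of a point. -/
lemma exists_bound_of_support_singleton {E : Type*} [NormedAddCommGroup E] [NormedSpace ℝ E]
    (T : Cr L F →ₗ[ℝ] E) (t : L) :
    ∃ M, ∀ f : Cr L F, (∀ x ∉ ({t} : Set L), (f : C(L, ℂ)) x = 0) → ‖T f‖ ≤ M * ‖f‖ := by
  let S : Submodule ℝ (Cr L F) :=
    { carrier := {f | ∀ x ∉ ({t} : Set L), (f : C(L, ℂ)) x = 0}
      add_mem' := fun {f g} hf hg x hx => by simp [hf x hx, hg x hx]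
      zero_mem' := fun x _ => by simp
      smul_mem' := fun c f hf x hx => by simp [hf x hx] }
  have hinj : Function.Injective ((evalCLM t : Cr L F →L[ℝ] ℂ).toLinearMap.comp S.subtype) := by
    intro f g hfg
    refine Subtype.ext (ext_apply fun x => ?_)
    by_cases hx : x = t
    · subst hx; exact hfg
    · rw [f.2 x hx, g.2 x hx]
  have : FiniteDimensional ℝ S := FiniteDimensional.of_injective _ hinj
  obtain ⟨M, hM⟩ := T.exists_bound_of_finiteDimensional_submodule S
  exact ⟨M, fun f hf => hM f hf⟩

end Cr

namespace OrthogonalityPreserving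

open Cr

variable {L₁ L₂ : Type*} [TopologicalSpace L₁] [CompactSpace L₁]
  [TopologicalSpace L₂] [CompactSpace L₂] {F₁ : Set L₁} {F₂ : Set L₂}

/-- `t` supports the functional `f ↦ T f s`. -/
def IsSupportPt (T : Cr L₁ F₁ →ₗ[ℝ] Cr L₂ F₂) (s : L₂) (t : L₁) : Prop :=
  ∀ g : Cr L₁ F₁, (∀ᶠ x in 𝓝 t, (g : C(L₁, ℂ)) x = 0) → (T g : C(L₂, ℂ)) s = 0

/-- `T` is unbounded on the functions of norm at most one supported in `U`. -/
def UnboundedOn (T : Cr L₁ F₁ →ₗ[ℝ] Cr L₂ F₂) (U : Set L₁) : Prop :=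
  ∀ M : ℝ, ∃ f : Cr L₁ F₁, (∀ x ∉ U, (f : C(L₁, ℂ)) x = 0) ∧ ‖f‖ ≤ 1 ∧ M < ‖T f‖

/-- The points near which `T` is unbounded. -/
def singularSet (T : Cr L₁ F₁ →ₗ[ℝ] Cr L₂ F₂) : Set L₁ := {t | ∀ U ∈ 𝓝 t, UnboundedOn T U}

/-- The points `s` for which the functional `f ↦ T f s` is bounded. -/
def boundedSet (T : Cr L₁ F₁ →ₗ[ℝ] Cr L₂ F₂) : Set L₂ :=
  {s | ∃ M, ∀ f, ‖(T f : C(L₂, ℂ)) s‖ ≤ M * ‖f‖}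

variable {T : Cr L₁ F₁ →ₗ[ℝ] Cr L₂ F₂}

lemma exists_isSupportPt [T2Space L₁] (hsurj : Function.Surjective T)
    (hT : ∀ f g : Cr L₁ F₁, f * g = 0 → T f * T g = 0) (s : L₂) : ∃ t, IsSupportPt T s t := by
  by_contra! hne
  simp only [IsSupportPt, not_forall] at hne
  choose g hg hgs using hne
  obtain ⟨f, hf⟩ := hsurj 1
  have key : ∀ t, ∀ k : Cr L₁ F₁,
      (∀ x ∉ interior {x | (g t : C(L₁, ℂ)) x = 0}, (k : C(L₁, ℂ)) x = 0) →
        (T k : C(L₂, ℂ)) s = 0 := by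
    intro t k hk
    refine (mul_eq_zero_iff.1 (hT k (g t) (mul_eq_zero_iff.2 fun x => ?_)) s).resolve_right (hgs t)
    by_cases hx : x ∈ interior {x | (g t : C(L₁, ℂ)) x = 0}
    · exact Or.inr ((interior_subset hx : x ∈ {x | (g t : C(L₁, ℂ)) x = 0}))
    · exact Or.inl (hk x hx)
  obtain ⟨I, hI⟩ := isCompact_univ.elim_finite_subcover
    (fun t => interior {x | (g t : C(L₁, ℂ)) x = 0}) (fun t => isOpen_interior)
    (fun t _ => mem_iUnion.2 ⟨t, mem_interior_iff_mem_nhds.2 (hg t)⟩)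
  obtain ⟨p, hp⟩ := PartitionOfUnity.exists_isSubordinate isClosed_univ
    (fun t : I => interior {x | (g t : C(L₁, ℂ)) x = 0}) (fun t => isOpen_interior)
    (fun x hx => by
      obtain ⟨t, ht, hxt⟩ := mem_iUnion₂.1 (hI hx)
      exact mem_iUnion.2 ⟨⟨t, ht⟩, hxt⟩)
  have hsum : f = ∑ t : I, ofReal (p t) * f := by
    refine ext_apply fun x => ?_
    have h1 : ∑ t : I, p t x = 1 := by
      rw [← finsum_eq_sum_of_fintype]; exact p.sum_eq_one (mem_univ x)
    have h2 : evalCLM x (∑ t : I, ofReal (p t) * f) =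
        ∑ t : I, ((p t x : ℝ) : ℂ) * (f : C(L₁, ℂ)) x := by
      rw [map_sum]; rfl
    rw [evalCLM_apply] at h2
    rw [h2, ← Finset.sum_mul, ← Complex.ofReal_sum, h1, Complex.ofReal_one, one_mul]
  have h0 : (T f : C(L₂, ℂ)) s = 0 := by
    rw [← evalCLM_apply, hsum, map_sum, map_sum]
    refine Finset.sum_eq_zero fun t _ => key t _ fun x hx => ?_
    have : p t x = 0 := by
      by_contra h
      exact hx (hp t (subset_tsupport _ h))
    simp [this]
  rw [hf] at h0
  simp at h0

lemma not_unboundedOn_pairwise_disjoint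
    (hT : ∀ f g : Cr L₁ F₁, f * g = 0 → T f * T g = 0) {U : ℕ → Set L₁}
    (hU : Pairwise (Function.onFun Disjoint U)) : ¬ ∀ n, UnboundedOn T (U n) := by
  intro hunb
  choose f hfU hf1 hfM using fun n : ℕ => hunb n (n * 2 ^ n)
  set e : ℕ → Cr L₁ F₁ := fun n => ((1 / 2 : ℝ) ^ n) • f n with he
  have hsumm : Summable e := by
    refine Summable.of_norm_bounded summable_geometric_two fun n => ?_
    rw [he, norm_smul, Real.norm_of_nonneg (by positivity)]
    exact mul_le_of_le_one_right (by positivity) (hf1 n)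
  have heU : ∀ n, ∀ x ∉ U n, (e n : C(L₁, ℂ)) x = 0 := fun n x hx => by simp [he, hfU n x hx]
  have hlarge : ∀ n : ℕ, (n : ℝ) < ‖T (e n)‖ := by
    intro n
    rw [he, map_smul, norm_smul, Real.norm_of_nonneg (by positivity), one_div, inv_pow]
    rw [← div_eq_inv_mul, lt_div_iff₀ (by positivity)]
    exact hfM n
  have horth : ∀ n, (∑' m, e m - e n) * e n = 0 := by
    intro n
    refine mul_eq_zero_iff.2 fun x => ?_
    by_cases hx : x ∈ U n
    · left
      have h1 : evalCLM x (∑' m, e m) = evalCLM x (e n) := by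
        rw [(evalCLM x).map_tsum hsumm]
        exact tsum_eq_single n fun m hm => heU m x fun hxm => (hU hm).le_bot ⟨hxm, hx⟩
      rw [← evalCLM_apply, map_sub, h1, sub_self]
    · exact Or.inr (heU n x hx)
  obtain ⟨n, hn⟩ := exists_nat_gt ‖T (∑' m, e m)‖
  refine absurd (hlarge n) (not_lt.2 (norm_le n.cast_nonneg fun s => ?_))
  rcases mul_eq_zero_iff.1 (hT _ _ (horth n)) s with h | h
  · rw [map_sub, ← evalCLM_apply, map_sub, sub_eq_zero] at h
    rw [← evalCLM_apply, ← h]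
    exact (norm_apply_le _ s).trans hn.le
  · rw [h, norm_zero]; exact n.cast_nonneg

lemma finite_singularSet [T2Space L₁] (hT : ∀ f g : Cr L₁ F₁, f * g = 0 → T f * T g = 0) :
    (singularSet T).Finite := by
  by_contra hinf
  obtain ⟨x, -, hx⟩ := Set.Infinite.exists_accPt_of_subset_isCompact hinf isCompact_univ
    (subset_univ _)
  have step : ∀ W : {W : Set L₁ // IsOpen W ∧ x ∈ W}, ∃ U : Set L₁,
      ∃ W' : {W : Set L₁ // IsOpen W ∧ x ∈ W}, UnboundedOn T U ∧ U ⊆ W ∧ Disjoint U W' ∧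
        (W' : Set L₁) ⊆ W := by
    rintro ⟨W, hW, hxW⟩
    obtain ⟨b, ⟨hbW, hb⟩, hbx⟩ := accPt_iff_nhds.1 hx W (hW.mem_nhds hxW)
    obtain ⟨U, V, hU, hV, hbU, hxV, hUV⟩ := t2_separation hbx
    exact ⟨U ∩ W, ⟨V ∩ W, hV.inter hW, hxV, hxW⟩,
      hb _ ((hU.inter hW).mem_nhds ⟨hbU, hbW⟩), inter_subset_right,
      hUV.mono inter_subset_left inter_subset_left, inter_subset_right⟩
  choose U W' hunb hUW hdisj hW'W using step
  let W : ℕ → {W : Set L₁ // IsOpen W ∧ x ∈ W} :=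
    fun n => Nat.rec ⟨univ, isOpen_univ, mem_univ x⟩ (fun _ w => W' w) n
  have hanti : Antitone fun n : ℕ => (W n).1 := by
    refine antitone_nat_of_succ_le ?_
    intro n
    exact hW'W (W n)
  have hlt : ∀ m n, m < n → Disjoint (U (W m)) (U (W n)) := fun m n hmn =>
    (hdisj (W m)).mono_right ((hUW (W n)).trans (hanti (Nat.succ_le_of_lt hmn)))
  refine not_unboundedOn_pairwise_disjoint hT (U := fun n => U (W n)) ?_ fun n => hunb (W n)
  intro m n hmn
  rcases hmn.lt_or_gt with h | h
  · exact hlt m n h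
  · exact (hlt n m h).symm

lemma singleton_notMem_nhds {t : L₁} (ht : t ∈ singularSet T) : {t} ∉ 𝓝 t := by
  intro h
  obtain ⟨M, hM⟩ := exists_bound_of_support_singleton T t
  obtain ⟨f, hf, hf1, hfM⟩ := ht _ h |M|
  have h1 := hM f hf
  have h2 : M * ‖f‖ ≤ |M| * 1 := mul_le_mul (le_abs_self M) hf1 (norm_nonneg _) (abs_nonneg _)
  linarith

lemma dense_compl_singularSet [T2Space L₁] (hT : ∀ f g : Cr L₁ F₁, f * g = 0 → T f * T g = 0) :
    Dense (singularSet T)ᶜ := by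
  rw [← interior_eq_empty_iff_dense_compl]
  by_contra! h
  obtain ⟨t, ht⟩ := h
  refine singleton_notMem_nhds (interior_subset ht) ?_
  have hfin := (finite_singularSet hT).subset (sdiff_subset (t := {t}))
  filter_upwards [isOpen_interior.mem_nhds ht, hfin.isClosed.isOpen_compl.mem_nhds (x := t) (by simp)]
    with y hy hy'
  by_contra hyt
  exact hy' ⟨interior_subset hy, hyt⟩

lemma exists_uniform_bound (T : Cr L₁ F₁ →ₗ[ℝ] Cr L₂ F₂) :
    ∃ C, ∀ s ∈ boundedSet T, ∀ f, ‖(T f : C(L₂, ℂ)) s‖ ≤ C * ‖f‖ := by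
  let g : boundedSet T → Cr L₁ F₁ →L[ℝ] ℂ := fun s =>
    ((evalCLM (s : L₂)).toLinearMap.comp T).mkContinuousOfExistsBound s.2
  obtain ⟨C, hC⟩ := banach_steinhaus (g := g) fun f => ⟨‖T f‖, fun s => norm_apply_le (T f) s⟩
  exact ⟨C, fun s hs f => (g ⟨s, hs⟩).le_of_opNorm_le (hC ⟨s, hs⟩) f⟩

lemma isClosed_boundedSet (T : Cr L₁ F₁ →ₗ[ℝ] Cr L₂ F₂) : IsClosed (boundedSet T) := by
  obtain ⟨C, hC⟩ := exists_uniform_bound T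
  have : boundedSet T = ⋂ f, {s | ‖(T f : C(L₂, ℂ)) s‖ ≤ C * ‖f‖} := by
    ext s
    simp only [mem_iInter, mem_ofPred_eq]
    exact ⟨fun hs => hC s hs, fun hs => ⟨C, hs⟩⟩
  rw [this]
  exact isClosed_iInter fun f => isClosed_le (by fun_prop) continuous_const

lemma mem_boundedSet_of_notMem_singularSet [T2Space L₁] {s : L₂} {t : L₁} (hst : IsSupportPt T s t)
    (ht : t ∉ singularSet T) : s ∈ boundedSet T := by
  simp only [singularSet, UnboundedOn, mem_ofPred_eq, not_forall, not_exists, not_and, not_lt] at ht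
  obtain ⟨U, hU, M, hM⟩ := ht
  obtain ⟨h, h1, h0, h01⟩ := exists_cutoff hU
  refine ⟨M, fun f => ?_⟩
  rcases eq_or_ne f 0 with rfl | hf
  · simp
  have hf' : 0 < ‖f‖ := norm_pos_iff.2 hf
  have hloc : (T f : C(L₂, ℂ)) s = (T (ofReal h * f) : C(L₂, ℂ)) s := by
    have := hst (f - ofReal h * f) (h1.mono fun y hy => by simp [hy])
    rw [map_sub, ← evalCLM_apply, map_sub, sub_eq_zero] at this
    exact this
  have hb := hM (‖f‖⁻¹ • (ofReal h * f)) (fun x hx => by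
    change ‖f‖⁻¹ • ((h x : ℂ) * (f : C(L₁, ℂ)) x) = 0
    rw [h0 x hx, Complex.ofReal_zero, zero_mul, smul_zero]) (by
    rw [norm_smul, norm_inv, norm_norm, inv_mul_le_iff₀ hf', mul_one]
    exact norm_ofReal_mul_le h01 f)
  rw [map_smul, norm_smul, norm_inv, norm_norm, inv_mul_le_iff₀ hf', mul_comm ‖f‖] at hb
  rw [hloc]
  exact (norm_apply_le _ s).trans hb

lemma apply_eq_zero_of_mem_boundedSet {s : L₂} {t : L₁} (hst : IsSupportPt T s t)
    (hs : s ∈ boundedSet T) {k : Cr L₁ F₁} (hk : (k : C(L₁, ℂ)) t = 0) :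
    (T k : C(L₂, ℂ)) s = 0 := by
  obtain ⟨M, hM⟩ := hs
  have hsmall : ∀ ε : ℝ, 0 < ε → ‖(T k : C(L₂, ℂ)) s‖ ≤ |M| * ε := by
    intro ε hε
    let u : C(L₁, ℝ) := ⟨fun x => min 1 (ε / max ε ‖(k : C(L₁, ℂ)) x‖), by
      refine continuous_const.min (continuous_const.div (by fun_prop) fun x => ?_)
      exact (lt_max_of_lt_left hε).ne'⟩
    have hu : ∀ x, u x = min 1 (ε / max ε ‖(k : C(L₁, ℂ)) x‖) := fun _ => rfl
    have hnhds : ∀ᶠ x in 𝓝 t, ‖(k : C(L₁, ℂ)) x‖ < ε := by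
      refine (isOpen_lt (f := fun x => ‖(k : C(L₁, ℂ)) x‖) (by fun_prop)
        continuous_const).mem_nhds ?_
      simpa [hk] using hε
    have hloc := hst (k - ofReal u * k) (hnhds.mono fun x hx => by
      have : u x = 1 := by rw [hu, max_eq_left hx.le, div_self hε.ne', min_self]
      simp [this])
    rw [map_sub, ← evalCLM_apply, map_sub, sub_eq_zero, evalCLM_apply, evalCLM_apply] at hloc
    have hnorm : ‖ofReal u * k‖ ≤ ε := norm_le hε.le fun x => by
      have hpos : 0 < max ε ‖(k : C(L₁, ℂ)) x‖ := lt_max_of_lt_left hε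
      have h0 : 0 ≤ u x := by rw [hu]; positivity
      calc ‖((ofReal u * k : Cr L₁ F₁) : C(L₁, ℂ)) x‖ = u x * ‖(k : C(L₁, ℂ)) x‖ := by
            simp [abs_of_nonneg h0]
        _ ≤ (ε / max ε ‖(k : C(L₁, ℂ)) x‖) * max ε ‖(k : C(L₁, ℂ)) x‖ :=
            mul_le_mul (min_le_right _ _) (le_max_right _ _) (norm_nonneg _) (by positivity)
        _ = ε := div_mul_cancel₀ _ hpos.ne'
    rw [hloc]
    exact (hM _).trans (mul_le_mul (le_abs_self M) hnorm (norm_nonneg _) (abs_nonneg _))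
  refine norm_le_zero_iff.1 (le_of_forall_pos_le_add fun δ hδ => ?_)
  refine (hsmall (δ / (|M| + 1)) (by positivity)).trans ?_
  rw [zero_add, mul_div_assoc', div_le_iff₀ (by positivity)]
  nlinarith [abs_nonneg M]

lemma boundedSet_eq_univ [T2Space L₁] [T2Space L₂] (hbij : Function.Bijective T)
    (hT : ∀ f g : Cr L₁ F₁, f * g = 0 → T f * T g = 0) : boundedSet T = univ := by
  by_contra hne
  obtain ⟨s₀, hs₀⟩ := (ne_univ_iff_exists_notMem _).1 hne
  obtain ⟨p, hp1, hp0, -⟩ := exists_cutoff ((isClosed_boundedSet T).isOpen_compl.mem_nhds hs₀)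
  obtain ⟨f, hf⟩ := hbij.2 (ofReal p)
  have hf0 : ∀ s ∈ boundedSet T, (T f : C(L₂, ℂ)) s = 0 := fun s hs => by
    rw [hf, ofReal_apply, hp0 s (fun h => h hs), Complex.ofReal_zero]
  have hzero : ∀ t ∈ (singularSet T)ᶜ, (f : C(L₁, ℂ)) t = 0 := by
    intro t ht
    obtain ⟨V, hVt, hVc, hVB⟩ := exists_mem_nhds_isClosed_subset
      ((finite_singularSet hT).isClosed.isOpen_compl.mem_nhds ht)
    obtain ⟨h, h1, h0, -⟩ := exists_cutoff hVt
    have hmul : T (ofReal h * f) = 0 := by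
      refine ext_apply fun s => ?_
      obtain ⟨r, hr⟩ := exists_isSupportPt hbij.2 hT s
      by_cases hs : s ∈ boundedSet T
      · have := apply_eq_zero_of_mem_boundedSet hr hs (k := ofReal h * f - h r • f) (by simp)
        rw [map_sub, map_smul, ← evalCLM_apply, map_sub, map_smul, evalCLM_apply, evalCLM_apply,
          hf0 s hs, smul_zero, sub_zero] at this
        exact this
      · have hrB : r ∈ Vᶜ := fun hrV =>
          hs (mem_boundedSet_of_notMem_singularSet hr (hVB hrV))
        exact hr _ (mem_of_superset (hVc.isOpen_compl.mem_nhds hrB) fun y hy => by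
          simp [h0 y hy])
    have h2 : ofReal h * f = 0 := hbij.1 (hmul.trans (map_zero T).symm)
    simpa [h1.self_of_nhds] using mul_eq_zero_iff.1 h2 t
  have hfz : f = 0 := ext_apply fun x => congrFun (Continuous.ext_on (dense_compl_singularSet hT)
    (f : C(L₁, ℂ)).continuous continuous_const fun t ht => hzero t ht) x
  have := congrArg (fun k : Cr L₂ F₂ => (k : C(L₂, ℂ)) s₀) hf
  simp [hfz, hp1.self_of_nhds] at this

end OrthogonalityPreserving

/-- Every orthogonality preserving real-linear bijection
`T : C_r(L₁) → C_r(L₂)` (not assumed bounded) is continuous.  (In `C_r(L)`, `f ⊥ g` iff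
`f g = 0`.) -/
theorem stmt_5 {L₁ L₂ : Type*}
    [TopologicalSpace L₁] [CompactSpace L₁] [T2Space L₁]
    [TopologicalSpace L₂] [CompactSpace L₂] [T2Space L₂]
    (F₁ : Set L₁) (F₂ : Set L₂) (hF₁ : IsClosed F₁) (hF₂ : IsClosed F₂)
    (T : Cr L₁ F₁ →ₗ[ℝ] Cr L₂ F₂) (hbij : Function.Bijective T)
    (hT : ∀ f g : Cr L₁ F₁, f * g = 0 → T f * T g = 0) :
    Continuous T := by
  obtain ⟨C, hC⟩ := OrthogonalityPreserving.exists_uniform_bound T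
  have hall := OrthogonalityPreserving.boundedSet_eq_univ hbij hT
  refine AddMonoidHomClass.continuous_of_bound T |C| fun f => ?_
  refine Cr.norm_le (by positivity) fun s => (hC s (hall ▸ Set.mem_univ s) f).trans ?_
  gcongr
  exact le_abs_self C
end
end

section
/- Let T : C_r(L₁) → C_r(L₂) be an orthogonality preserving real-linear bijection (not assumed bounded). Then T⁻¹ preserves invertible elements: for every f ∈ C_r(L₁), if Tf is invertible in C_r(L₂), then f is invertible in C_r(L₁). -/
noncomputable section
set_option synthInstance.maxHeartbeats 1000000
set_option maxHeartbeats 1000000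

/-- A continuous staircase: constant near every point of fractional part above `1/3`, and at
distance at most `1` from the identity. -/
def staircase (x : ℝ) : ℝ := x + (min 1 (3 * Int.fract x) - Int.fract x)

lemma staircase_continuous : Continuous staircase := by
  have h : Continuous ((fun t : ℝ => min 1 (3 * t) - t) ∘ Int.fract) := by
    refine ContinuousOn.comp_fract'' (Continuous.continuousOn (by fun_prop)) ?_
    norm_num
  exact continuous_id.add h

lemma le_staircase (x : ℝ) : x ≤ staircase x := by
  have h0 := Int.fract_nonneg x
  have h1 := Int.fract_lt_one x
  have : Int.fract x ≤ min 1 (3 * Int.fract x) := le_min h1.le (by linarith)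
  unfold staircase
  linarith

lemma staircase_le (x : ℝ) : staircase x ≤ x + 1 := by
  have h0 := Int.fract_nonneg x
  have := min_le_left 1 (3 * Int.fract x)
  unfold staircase
  linarith

lemma staircase_eventually_eq {x : ℝ} (hx : 1 / 3 < Int.fract x) :
    ∀ᶠ y in nhds x, staircase y = staircase x := by
  have key : ∀ y : ℝ, (⌊x⌋ : ℝ) + 1 / 3 < y → y < ⌊x⌋ + 1 → staircase y = ⌊x⌋ + 1 := by
    intro y h1 h2
    have hfl : ⌊y⌋ = ⌊x⌋ := Int.floor_eq_iff.2 ⟨by linarith, h2⟩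
    have hfr : Int.fract y = y - ⌊x⌋ := by rw [← hfl]; rfl
    rw [staircase, hfr, min_eq_left (by linarith)]
    ring
  have hx1 : (⌊x⌋ : ℝ) + 1 / 3 < x := by
    have := Int.floor_add_fract x
    linarith
  have hx2 := Int.lt_floor_add_one x
  filter_upwards [Ioo_mem_nhds hx1 hx2] with y hy
  rw [key y hy.1 hy.2, key x hx1 hx2]

lemma one_third_lt_fract_or (x : ℝ) :
    1 / 3 < Int.fract x ∨ 1 / 3 < Int.fract (1 / 2 + x) := by
  by_contra! h
  have h0 := Int.fract_nonneg x
  have e : Int.fract (1 / 2 + x) = 1 / 2 + Int.fract x := by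
    rw [Int.fract_eq_iff]
    refine ⟨by linarith, by linarith, ⌊x⌋, ?_⟩
    have := Int.floor_add_fract x
    linarith
  linarith

/-- Radial rescaling of the plane by a staircase function of `-log ‖z‖`. -/
def staircaseScale (d : ℝ) (z : ℂ) : ℂ := (staircase (d - Real.log ‖z‖) : ℂ) * z

lemma staircaseScale_continuous (d : ℝ) : Continuous (staircaseScale d) := by
  rw [continuous_iff_continuousAt]
  intro z
  by_cases hz : z = 0
  · subst hz
    have hlim : Filter.Tendsto (fun z : ℂ => (|d| + 1) * ‖z‖ + |‖z‖ * Real.log ‖z‖|)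
        (nhds 0) (nhds 0) := by
      have hc : Continuous fun z : ℂ => (|d| + 1) * ‖z‖ + |‖z‖ * Real.log ‖z‖| :=
        (continuous_const.mul continuous_norm).add
          (Real.continuous_mul_log.comp continuous_norm).abs
      simpa using hc.tendsto 0
    have h0 : staircaseScale d 0 = 0 := by simp [staircaseScale]
    rw [ContinuousAt, h0]
    refine squeeze_zero_norm (fun z => ?_) hlim
    rw [staircaseScale, norm_mul, Complex.norm_real, Real.norm_eq_abs, abs_mul, abs_norm]
    have hb : |staircase (d - Real.log ‖z‖)| ≤ |d| + 1 + |Real.log ‖z‖| := by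
      have h1 := le_staircase (d - Real.log ‖z‖)
      have h2 := staircase_le (d - Real.log ‖z‖)
      have h3 := abs_le.1 (le_refl |d|)
      have h4 := abs_le.1 (le_refl |Real.log ‖z‖|)
      exact abs_le.2 ⟨by linarith, by linarith⟩
    nlinarith [norm_nonneg z]
  · have hlog : ContinuousAt (fun z : ℂ => d - Real.log ‖z‖) z :=
      continuousAt_const.sub (continuousAt_id.norm.log (norm_ne_zero_iff.2 hz))
    exact (Complex.continuous_ofReal.continuousAt.comp
      (staircase_continuous.continuousAt.comp hlog)).mul continuousAt_id

namespace Cr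

variable {L : Type*} [TopologicalSpace L] {F : Set L}

lemma isUnit_of_forall_ne_zero {f : Cr L F} (hf : ∀ t, f.1 t ≠ 0) : IsUnit f := by
  let g : Cr L F := ⟨⟨fun t => (f.1 t)⁻¹, f.1.continuous.inv₀ hf⟩, fun t ht => by
    have := f.2 t ht
    simp [Complex.inv_im, this]⟩
  refine IsUnit.of_mul_eq_one g (Subtype.ext (ContinuousMap.ext fun t => ?_))
  exact mul_inv_cancel₀ (hf t)

/-- Post-composition of an element of `C_r(L)` with `staircaseScale d`. -/
def scale (d : ℝ) (f : Cr L F) : Cr L F :=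
  ⟨⟨fun t => staircaseScale d (f.1 t), (staircaseScale_continuous d).comp f.1.continuous⟩,
    fun t ht => by
      have := f.2 t ht
      simp [staircaseScale, this]⟩

lemma scale_eventually_eq {d : ℝ} {f : Cr L F} {t : L} (ht : f.1 t ≠ 0)
    (hd : 1 / 3 < Int.fract (d - Real.log ‖f.1 t‖)) :
    ∀ᶠ u in nhds t, (scale d f - staircase (d - Real.log ‖f.1 t‖) • f).1 u = 0 := by
  have hlog : ContinuousAt (fun u => d - Real.log ‖f.1 u‖) t :=
    continuousAt_const.sub (f.1.continuous.continuousAt.norm.log (norm_ne_zero_iff.2 ht))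
  filter_upwards [hlog.eventually (staircase_eventually_eq hd)] with u hu
  change staircaseScale d (f.1 u) - staircase (d - Real.log ‖f.1 t‖) • f.1 u = 0
  rw [staircaseScale, hu, Complex.real_smul, sub_self]

lemma exists_ne_zero_mul_eq_zero [CompactSpace L] [T2Space L] {p : Cr L F} {t : L}
    (hp : ∀ᶠ u in nhds t, p.1 u = 0) : ∃ g : Cr L F, g ≠ 0 ∧ g * p = 0 := by
  obtain ⟨V, hV, hVo, htV⟩ := eventually_nhds_iff.1 hp
  obtain ⟨φ, h0, h1, -⟩ := exists_continuous_zero_one_of_isClosed hVo.isClosed_compl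
    (isClosed_singleton (x := t)) (Set.disjoint_singleton_right.2 (by simpa using htV))
  let g : Cr L F := ⟨⟨fun u => (φ u : ℂ), by fun_prop⟩, fun u _ => by simp⟩
  refine ⟨g, fun hg => ?_, Subtype.ext (ContinuousMap.ext fun u => ?_)⟩
  · have e : g.1 t = 0 := by rw [hg]; rfl
    have e1 : φ t = 1 := h1 rfl
    change (φ t : ℂ) = 0 at e
    simp [e1] at e
  · change (φ u : ℂ) * p.1 u = 0
    by_cases hu : u ∈ V
    · simp [hV u hu]
    · have e0 : φ u = 0 := h0 hu
      simp [e0]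

/-- The image of a function vanishing on a nonempty open set has a zero. -/
lemma exists_map_eq_zero [CompactSpace L] [T2Space L] {L' : Type*} [TopologicalSpace L']
    {F' : Set L'} {T : Cr L F →ₗ[ℝ] Cr L' F'} (hinj : Function.Injective T)
    (hT : ∀ f g : Cr L F, f * g = 0 → T f * T g = 0) {p : Cr L F} {t : L}
    (hp : ∀ᶠ u in nhds t, p.1 u = 0) : ∃ s, (T p).1 s = 0 := by
  obtain ⟨g, hg, hgp⟩ := exists_ne_zero_mul_eq_zero hp
  by_contra! hs
  refine hg (hinj ?_)
  rw [map_zero]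
  refine Subtype.ext (ContinuousMap.ext fun s => ?_)
  have e : (T g * T p).1 s = 0 := by rw [hT g p hgp]; rfl
  change (T g).1 s * (T p).1 s = 0 at e
  exact (mul_eq_zero.1 e).resolve_right (hs s)

end Cr

/-- If `T : C_r(L₁) → C_r(L₂)` is an orthogonality preserving real-linear
bijection (not assumed bounded), then `T⁻¹` preserves invertible elements: if `T f` is
invertible in `C_r(L₂)` then `f` is invertible in `C_r(L₁)`. -/
theorem stmt_6 {L₁ L₂ : Type*}
    [TopologicalSpace L₁] [CompactSpace L₁] [T2Space L₁]
    [TopologicalSpace L₂] [CompactSpace L₂] [T2Space L₂]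
    (F₁ : Set L₁) (F₂ : Set L₂) (hF₁ : IsClosed F₁) (hF₂ : IsClosed F₂)
    (T : Cr L₁ F₁ →ₗ[ℝ] Cr L₂ F₂) (hbij : Function.Bijective T)
    (hT : ∀ f g : Cr L₁ F₁, f * g = 0 → T f * T g = 0) :
    ∀ f : Cr L₁ F₁, IsUnit (T f) → IsUnit f := by
  intro f hf
  by_contra hnu
  obtain ⟨t₀, ht₀⟩ : ∃ t, f.1 t = 0 := by
    by_contra! h
    exact hnu (Cr.isUnit_of_forall_ne_zero h)
  obtain ⟨w, hw⟩ := hf.exists_right_inv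
  have hws : ∀ s, (T f).1 s * w.1 s = 1 := fun s => by
    have e : (T f * w).1 s = 1 := by rw [hw]; rfl
    exact e
  have hbound : ∀ (d : ℝ) (t : L₁), f.1 t ≠ 0 → 1 / 3 < Int.fract (d - Real.log ‖f.1 t‖) →
      staircase (d - Real.log ‖f.1 t‖) ≤ ‖(T (Cr.scale d f) * w).1‖ := by
    intro d t ht hd
    set c := staircase (d - Real.log ‖f.1 t‖)
    obtain ⟨s, hs⟩ := Cr.exists_map_eq_zero hbij.1 hT (Cr.scale_eventually_eq ht hd)
    rw [map_sub, map_smul] at hs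
    replace hs : (T (Cr.scale d f)).1 s - (c : ℂ) * (T f).1 s = 0 := by
      rw [← Complex.real_smul]
      exact hs
    have e : (T (Cr.scale d f) * w).1 s = c := by
      change (T (Cr.scale d f)).1 s * w.1 s = c
      rw [sub_eq_zero.1 hs, mul_assoc, hws, mul_one]
    calc c ≤ ‖(c : ℂ)‖ := by rw [Complex.norm_real]; exact le_abs_self c
      _ = ‖(T (Cr.scale d f) * w).1 s‖ := by rw [e]
      _ ≤ _ := ContinuousMap.norm_coe_le_norm _ s
  set M := max ‖(T (Cr.scale 0 f) * w).1‖ ‖(T (Cr.scale (1 / 2) f) * w).1‖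
  have hfreq : ∃ᶠ t in nhds t₀, f.1 t ≠ 0 := by
    intro h
    obtain ⟨s, hs⟩ := Cr.exists_map_eq_zero hbij.1 hT (h.mono fun t ht => not_not.1 ht)
    simpa [hs] using hws s
  have hsmall : ∀ᶠ t in nhds t₀, ‖f.1 t‖ < Real.exp (-M) :=
    f.1.continuous.norm.continuousAt.eventually_lt continuousAt_const
      (by simpa [ht₀] using Real.exp_pos (-M))
  obtain ⟨t, ht, htM⟩ := (hfreq.and_eventually hsmall).exists
  have hlog : Real.log ‖f.1 t‖ < -M := (Real.log_lt_iff_lt_exp (norm_pos_iff.2 ht)).2 htM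
  rcases one_third_lt_fract_or (-Real.log ‖f.1 t‖) with h | h
  · have h1 := hbound 0 t ht (by rwa [zero_sub])
    have h2 := le_staircase (0 - Real.log ‖f.1 t‖)
    have h3 : _ ≤ M := le_max_left _ _
    linarith
  · have h1 := hbound (1 / 2) t ht (by rwa [sub_eq_add_neg])
    have h2 := le_staircase (1 / 2 - Real.log ‖f.1 t‖)
    have h3 : _ ≤ M := le_max_right _ _
    linarith
end
end
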